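/- arXiv:2009.04492 — 5 statements merged into one kernel-verified Lean document; each statement's English description precedes it below -/
import Mathlib

section
/- Let f : ℝ → ℂ be a bounded continuous characteristic function satisfying ∫ℝ |f(t)|/(1 + |t|) dt < ∞, and let k_f denote its Cauchy transform. Then the function y ↦ −k_f(iy) is real-valued and absolutely monotonic on (−∞, 0), i.e., all of its derivatives are nonnegative on (−∞, 0). -/
open MeasureTheory Complex Set
open scoped ENNReal ComplexOrder

noncomputable def cauchyTransform (f : ℝ → ℂ) (z : ℂ) : ℂ :=
  (Complex.I / (Real.pi : ℂ)) * ∫ t : ℝ, f t / (z - (t : ℂ))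

noncomputable def modCauchyTransform (f : ℝ → ℂ) (z : ℂ) : ℂ :=
  (Complex.I / (Real.pi : ℂ)) *
    ∫ t : ℝ, (1 / (z - (t : ℂ)) + (t : ℂ) / ((t : ℂ) ^ 2 + 1)) * f t

def CompletelyMonotonicOn (ω : ℝ → ℝ) (s : Set ℝ) : Prop :=
  ContDiffOn ℝ (⊤ : ℕ∞) ω s ∧ ∀ (n : ℕ), ∀ x ∈ s, 0 ≤ (-1 : ℝ) ^ n * iteratedDeriv n ω x

def AbsolutelyMonotonicOn (ω : ℝ → ℝ) (s : Set ℝ) : Prop :=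
  ContDiffOn ℝ (⊤ : ℕ∞) ω s ∧ ∀ (n : ℕ), ∀ x ∈ s, 0 ≤ iteratedDeriv n ω x

def IsCharFun (f : ℝ → ℂ) : Prop :=
  ∃ σ : Measure ℝ, IsProbabilityMeasure σ ∧
    ∀ x : ℝ, f x = ∫ t : ℝ, Complex.exp (Complex.I * x * t) ∂σ

/-- Regularised kernel. -/
noncomputable def phiK (a b : ℝ) (t : ℝ) : ℂ :=
  1 / ((a : ℂ) - Complex.I * t) - 1 / ((b : ℂ) - Complex.I * t)

/-- Its inverse transform. -/
noncomputable def hK (a b : ℝ) (s : ℝ) : ℂ :=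
  ((Real.exp (-a * max s 0) - Real.exp (-b * max s 0) : ℝ) : ℂ)

lemma den_ne {a : ℝ} (ha : 0 < a) (t : ℝ) : (a : ℂ) - Complex.I * t ≠ 0 := by
  intro h
  have := congrArg Complex.re h
  simp at this
  exact ha.ne' this

lemma den_sq (a t : ℝ) : ‖(a : ℂ) - Complex.I * t‖ ^ 2 = a ^ 2 + t ^ 2 := by
  rw [← Complex.normSq_eq_norm_sq, Complex.normSq_apply]
  simp
  ring


lemma den_ge_left (a t : ℝ) : a ≤ ‖(a : ℂ) - Complex.I * t‖ := by
  apply le_of_abs_le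
  apply abs_le_of_sq_le_sq _ (norm_nonneg _)
  rw [den_sq]
  nlinarith [sq_nonneg t]

lemma den_ge_right (a t : ℝ) : |t| ≤ ‖(a : ℂ) - Complex.I * t‖ := by
  apply abs_le_of_sq_le_sq _ (norm_nonneg _)
  rw [den_sq]
  nlinarith [sq_nonneg a]

lemma phiK_eq {a b : ℝ} (ha : 0 < a) (hab : a < b) (t : ℝ) :
    phiK a b t = ((b - a : ℝ) : ℂ) /
      (((a : ℂ) - Complex.I * t) * ((b : ℂ) - Complex.I * t)) := by
  have h1 := den_ne ha t
  have h2 := den_ne (ha.trans hab) t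
  unfold phiK
  rw [div_sub_div _ _ h1 h2]
  congr 1
  push_cast
  ring

lemma phiK_norm_le {a b : ℝ} (ha : 0 < a) (hab : a < b) (t : ℝ) :
    ‖phiK a b t‖ ≤ 1 / ‖(a : ℂ) - Complex.I * t‖ := by
  have h1 : 0 < ‖(a : ℂ) - Complex.I * t‖ := norm_pos_iff.2 (den_ne ha t)
  have h2 : 0 < ‖(b : ℂ) - Complex.I * t‖ := norm_pos_iff.2 (den_ne (ha.trans hab) t)
  have h3 := den_ge_left b t
  rw [phiK_eq ha hab, norm_div, norm_mul, Complex.norm_real, Real.norm_eq_abs,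
    abs_of_pos (sub_pos.2 hab), div_le_div_iff₀ (by positivity) h1]
  nlinarith

lemma phiK_cont {a b : ℝ} (ha : 0 < a) (hab : a < b) : Continuous (phiK a b) := by
  unfold phiK
  refine Continuous.sub ?_ ?_
  · exact Continuous.div (by fun_prop) (by fun_prop) (den_ne ha)
  · exact Continuous.div (by fun_prop) (by fun_prop) (den_ne (ha.trans hab))

lemma phiK_int {a b : ℝ} (ha : 0 < a) (hab : a < b) : Integrable (phiK a b) := by
  refine Integrable.mono' (integrable_inv_one_add_sq.const_mul ((b - a) * (1 + 1 / a ^ 2)))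
    (phiK_cont ha hab).aestronglyMeasurable (Filter.Eventually.of_forall fun t => ?_)
  have h1 : 0 < ‖(a : ℂ) - Complex.I * t‖ := norm_pos_iff.2 (den_ne ha t)
  have h12 : ‖(a : ℂ) - Complex.I * t‖ ≤ ‖(b : ℂ) - Complex.I * t‖ := by
    apply le_of_abs_le
    apply abs_le_of_sq_le_sq _ (norm_nonneg _)
    rw [den_sq, den_sq]
    nlinarith
  have hs := den_sq a t
  rw [phiK_eq ha hab, norm_div, norm_mul, Complex.norm_real, Real.norm_eq_abs,
    abs_of_pos (sub_pos.2 hab), mul_assoc, div_eq_mul_inv]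
  refine mul_le_mul_of_nonneg_left ?_ (sub_pos.2 hab).le
  have h4 : a ^ 2 + t ^ 2 ≤ ‖(a : ℂ) - Complex.I * t‖ * ‖(b : ℂ) - Complex.I * t‖ := by
    rw [← hs]; nlinarith
  have h5 : 0 < a ^ 2 + t ^ 2 := by positivity
  calc _ ≤ (a ^ 2 + t ^ 2)⁻¹ := inv_anti₀ h5 h4
    _ ≤ _ := by
      rw [← div_eq_mul_inv, inv_eq_one_div, div_le_div_iff₀ h5 (by positivity)]
      have : (1 + 1 / a ^ 2) * (a ^ 2 + t ^ 2) = 1 + t ^ 2 + (a ^ 2 + t ^ 2 / a ^ 2) := by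
        field_simp
        ring
      rw [this]
      have : 0 ≤ a ^ 2 + t ^ 2 / a ^ 2 := by positivity
      linarith

lemma hK_cont (a b : ℝ) : Continuous (hK a b) := by
  unfold hK
  fun_prop

lemma hK_ind (a b : ℝ) (w : ℝ) :
    (fun v : ℝ => Complex.exp (↑(-2 * Real.pi * v * w) * Complex.I) • hK a b v) =
      (Ioi (0 : ℝ)).indicator (fun v : ℝ =>
        Complex.exp (-((a : ℂ) - Complex.I * ((-(2 * Real.pi) * w : ℝ) : ℂ)) * v) -
        Complex.exp (-((b : ℂ) - Complex.I * ((-(2 * Real.pi) * w : ℝ) : ℂ)) * v)) := by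
  ext v
  by_cases hv : 0 < v
  · rw [indicator_of_mem (by exact hv)]
    unfold hK
    rw [max_eq_left hv.le, smul_eq_mul]
    push_cast
    rw [mul_sub, ← Complex.exp_add, ← Complex.exp_add]
    congr 2 <;> ring
  · rw [indicator_of_notMem (by exact hv)]
    unfold hK
    rw [max_eq_right (not_lt.1 hv)]
    simp

lemma exp_intOn {a : ℝ} (ha : 0 < a) (u : ℝ) :
    IntegrableOn (fun v : ℝ => Complex.exp (-((a : ℂ) - Complex.I * (u : ℂ)) * v)) (Ioi 0) :=
  integrableOn_exp_mul_complex_Ioi (by simpa using ha) 0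

lemma exp_integral {a : ℝ} (ha : 0 < a) (u : ℝ) :
    ∫ v : ℝ in Ioi 0, Complex.exp (-((a : ℂ) - Complex.I * (u : ℂ)) * v) =
      1 / ((a : ℂ) - Complex.I * u) := by
  rw [integral_exp_mul_complex_Ioi (by simpa using ha) 0]
  rw [Complex.ofReal_zero, mul_zero, Complex.exp_zero, neg_div_neg_eq]

lemma hK_int {a b : ℝ} (ha : 0 < a) (hab : a < b) : Integrable (hK a b) := by
  have h := hK_ind a b 0
  have : hK a b = (fun v : ℝ => Complex.exp (↑(-2 * Real.pi * v * 0) * Complex.I) • hK a b v) := by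
    ext v; simp
  rw [this, h]
  exact ((exp_intOn ha _).sub (exp_intOn (ha.trans hab) _)).integrable_indicator measurableSet_Ioi

open FourierTransform in
lemma hK_fourier {a b : ℝ} (ha : 0 < a) (hab : a < b) :
    𝓕 (hK a b) = fun w => phiK a b (-(2 * Real.pi) * w) := by
  ext w
  rw [Real.fourier_real_eq_integral_exp_smul, hK_ind, integral_indicator measurableSet_Ioi,
    integral_sub (exp_intOn ha _) (exp_intOn (ha.trans hab) _), exp_integral ha,
    exp_integral (ha.trans hab)]
  rfl

open FourierTransform in
lemma phiK_integral {a b : ℝ} (ha : 0 < a) (hab : a < b) (x : ℝ) :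
    ∫ t : ℝ, Complex.exp (Complex.I * t * x) * phiK a b t = 2 * Real.pi * hK a b (-x) := by
  have hpi := Real.pi_pos
  have h := congrFun ((hK_cont a b).fourierInv_fourier_eq (hK_int ha hab) (by
    rw [hK_fourier ha hab]
    exact (phiK_int ha hab).comp_mul_left' (by nlinarith))) (-x)
  rw [hK_fourier ha hab, Real.fourierInv_eq'] at h
  rw [← h]
  have h2 := Measure.integral_comp_mul_left
    (fun t : ℝ => Complex.exp (Complex.I * t * x) * phiK a b t) (-(2 * Real.pi))
  have h3 : ∀ v : ℝ, Complex.exp ((↑(2 * Real.pi * inner ℝ v (-x)) * Complex.I)) •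
      phiK a b (-(2 * Real.pi) * v) =
      Complex.exp (Complex.I * ((-(2 * Real.pi) * v : ℝ) : ℂ) * x) *
        phiK a b (-(2 * Real.pi) * v) := by
    intro v
    rw [smul_eq_mul]
    congr 2
    simp
    ring
  simp_rw [h3]
  rw [h2, abs_inv, abs_neg, abs_of_pos (by positivity), Complex.real_smul]
  have hpi' : (Real.pi : ℂ) ≠ 0 := by exact_mod_cast Real.pi_ne_zero
  push_cast
  rw [← mul_assoc, mul_inv_cancel₀ (mul_ne_zero two_ne_zero hpi'), one_mul]

lemma swap_K {f : ℝ → ℂ} {σ : Measure ℝ} [IsProbabilityMeasure σ]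
    (hf : ∀ x : ℝ, f x = ∫ t : ℝ, Complex.exp (Complex.I * x * t) ∂σ)
    {a b : ℝ} (ha : 0 < a) (hab : a < b) :
    ∫ t : ℝ, f t * phiK a b t = ∫ x, 2 * Real.pi * hK a b (-x) ∂σ := by
  simp_rw [← phiK_integral ha hab, hf, ← integral_mul_const]
  refine integral_integral_swap ?_
  have h1 : Integrable (fun p : ℝ × ℝ => phiK a b p.1) (volume.prod σ) :=
    (phiK_int ha hab).comp_fst σ
  refine h1.bdd_mul (c := 1) (by
    apply Continuous.aestronglyMeasurable
    fun_prop) (Filter.Eventually.of_forall fun p => ?_)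
  rw [Complex.norm_exp]
  simp

lemma int_f {f : ℝ → ℂ} (hc : Continuous f)
    (hint : Integrable (fun t : ℝ => ‖f t‖ / (1 + |t|))) {a : ℝ} (ha : 0 < a) :
    Integrable (fun t : ℝ => ‖f t‖ * (1 / ‖(a : ℂ) - Complex.I * t‖)) := by
  refine Integrable.mono' (hint.const_mul (1 / a + 1)) ?_ (Filter.Eventually.of_forall fun t => ?_)
  · apply Continuous.aestronglyMeasurable
    refine hc.norm.mul (Continuous.div (by fun_prop) (by fun_prop) fun t => ?_)
    exact norm_ne_zero_iff.2 (den_ne ha t)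
  · have h1 : 0 < ‖(a : ℂ) - Complex.I * t‖ := norm_pos_iff.2 (den_ne ha t)
    have h2 := den_ge_left a t
    have h3 := den_ge_right a t
    rw [Real.norm_of_nonneg (by positivity), mul_one_div, mul_div_assoc', 
      div_le_div_iff₀ h1 (by positivity)]
    have h4 : 1 ≤ 1 / a * ‖(a : ℂ) - Complex.I * t‖ := by
      rw [one_div_mul_eq_div, le_div_iff₀ ha]; linarith
    calc _ ≤ ‖f t‖ * ((1 / a + 1) * ‖(a : ℂ) - Complex.I * t‖) := by
          apply mul_le_mul_of_nonneg_left _ (norm_nonneg _)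
          linarith
      _ = _ := by ring

lemma hK_lim {a : ℝ} (x : ℝ) :
    Filter.Tendsto (fun n : ℕ => hK a (a + 1 + n) (-x)) Filter.atTop
      (nhds ((Iio (0 : ℝ)).indicator (fun x => ((Real.exp (a * x) : ℝ) : ℂ)) x)) := by
  by_cases hx : x < 0
  · rw [indicator_of_mem (by exact hx)]
    unfold hK
    rw [max_eq_left (by linarith)]
    refine (Complex.continuous_ofReal.tendsto _).comp ?_
    have : Real.exp (a * x) = Real.exp (-a * -x) - 0 := by simp
    rw [this]
    refine tendsto_const_nhds.sub (Real.tendsto_exp_atBot.comp ?_)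
    have h : Filter.Tendsto (fun n : ℕ => (a + 1 + (n : ℝ)) * x) Filter.atTop Filter.atBot :=
      (Filter.tendsto_atTop_add_const_left _ _ tendsto_natCast_atTop_atTop).atTop_mul_const_of_neg hx
    refine h.congr fun n => ?_
    ring
  · rw [indicator_of_notMem (by exact hx)]
    unfold hK
    rw [max_eq_right (by linarith)]
    simp

lemma key {f : ℝ → ℂ} (hc : Continuous f) {σ : Measure ℝ} [IsProbabilityMeasure σ]
    (hf : ∀ x : ℝ, f x = ∫ t : ℝ, Complex.exp (Complex.I * x * t) ∂σ)
    (hint : Integrable (fun t : ℝ => ‖f t‖ / (1 + |t|))) {a : ℝ} (ha : 0 < a) :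
    ∫ t : ℝ, f t / ((a : ℂ) - Complex.I * t) =
      ((2 * Real.pi * ∫ x in Iio 0, Real.exp (a * x) ∂σ : ℝ) : ℂ) := by
  have hab : ∀ n : ℕ, a < a + 1 + n := fun n => by
    have : (0 : ℝ) ≤ n := n.cast_nonneg
    linarith
  have L1 : Filter.Tendsto (fun n : ℕ => ∫ t : ℝ, f t * phiK a (a + 1 + n) t) Filter.atTop
      (nhds (∫ t : ℝ, f t / ((a : ℂ) - Complex.I * t))) := by
    refine tendsto_integral_of_dominated_convergence _
      (fun n => (hc.mul (phiK_cont ha (hab n))).aestronglyMeasurable) (int_f hc hint ha)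
      (fun n => Filter.Eventually.of_forall fun t => ?_)
      (Filter.Eventually.of_forall fun t => ?_)
    · rw [norm_mul]
      exact mul_le_mul_of_nonneg_left (phiK_norm_le ha (hab n) t) (norm_nonneg _)
    · have : f t / ((a : ℂ) - Complex.I * t) = f t * (1 / ((a : ℂ) - Complex.I * t) - 0) := by
        rw [sub_zero, mul_one_div]
      rw [this]
      refine tendsto_const_nhds.mul (tendsto_const_nhds.sub ?_)
      rw [tendsto_zero_iff_norm_tendsto_zero]
      have h0 : Filter.Tendsto (fun n : ℕ => 1 / ((n : ℝ) + 1)) Filter.atTop (nhds 0) :=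
        tendsto_one_div_add_atTop_nhds_zero_nat
      refine squeeze_zero (fun n => norm_nonneg _) (fun n => ?_) h0
      have h := den_ge_left (a + 1 + n) t
      rw [norm_div, norm_one]
      refine one_div_le_one_div_of_le (by positivity) ?_
      linarith
  have L2 : Filter.Tendsto (fun n : ℕ => ∫ x, 2 * Real.pi * hK a (a + 1 + n) (-x) ∂σ) Filter.atTop
      (nhds (∫ x, 2 * Real.pi *
        (Iio (0 : ℝ)).indicator (fun x => ((Real.exp (a * x) : ℝ) : ℂ)) x ∂σ)) := by
    refine tendsto_integral_of_dominated_convergence (fun _ => 2 * Real.pi)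
      (fun n => ?_) (integrable_const _)
      (fun n => Filter.Eventually.of_forall fun t => ?_)
      (Filter.Eventually.of_forall fun t => tendsto_const_nhds.mul (hK_lim t))
    · exact (continuous_const.mul ((hK_cont _ _).comp continuous_neg)).aestronglyMeasurable
    · have hpi := Real.pi_pos
      have h1 : ‖hK a (a + 1 + n) (-t)‖ ≤ 1 := by
        unfold hK
        rw [Complex.norm_real, Real.norm_eq_abs]
        have hm : 0 ≤ max (-t) 0 := le_max_right _ _
        have e1 : Real.exp (-a * max (-t) 0) ≤ 1 := Real.exp_le_one_iff.2 (by nlinarith)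
        have e2 : Real.exp (-(a + 1 + n) * max (-t) 0) ≤ 1 :=
          Real.exp_le_one_iff.2 (by nlinarith [hab n])
        have e3 := Real.exp_pos (-a * max (-t) 0)
        have e4 := Real.exp_pos (-(a + 1 + n) * max (-t) 0)
        rw [abs_le]
        constructor <;> linarith
      rw [norm_mul, norm_mul, Complex.norm_real, Real.norm_of_nonneg hpi.le, Complex.norm_ofNat]
      nlinarith
  simp_rw [← fun n : ℕ => swap_K hf ha (hab n)] at L2
  rw [tendsto_nhds_unique L1 L2, integral_const_mul, integral_indicator measurableSet_Iio,
    integral_complex_ofReal]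
  push_cast
  rfl

/-- Necessity, lower half-plane part of Theorem 3: if `f` is a bounded continuous
characteristic function satisfying (1.7), then `y ↦ -k_f(iy)` is real-valued and
absolutely monotonic on `(-∞,0)`. -/
theorem stmt_4 (f : ℝ → ℂ) (hc : Continuous f) (hb : ∃ M : ℝ, ∀ x : ℝ, ‖f x‖ ≤ M)
    (hchar : IsCharFun f) (hint : Integrable (fun t : ℝ => ‖f t‖ / (1 + |t|))) :
    (∀ y ∈ Iio (0 : ℝ), (-(cauchyTransform f (Complex.I * y))).im = 0) ∧
      AbsolutelyMonotonicOn (fun y : ℝ => (-(cauchyTransform f (Complex.I * y))).re) (Iio 0) := by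
  obtain ⟨σ, hσ, hf⟩ := hchar
  have hk : ∀ y : ℝ, y < 0 → -(cauchyTransform f (Complex.I * y)) =
      ((2 * ProbabilityTheory.mgf (fun x : ℝ => -x) (σ.restrict (Iio 0)) y : ℝ) : ℂ) := by
    intro y hy
    have h := key hc hf hint (neg_pos.2 hy)
    have h1 : ∀ t : ℝ, f t / (Complex.I * y - t) =
        Complex.I * (f t / (((-y : ℝ) : ℂ) - Complex.I * t)) := by
      intro t
      have h2 := den_ne (neg_pos.2 hy) t
      have h3 : Complex.I * y - t = -Complex.I * (((-y : ℝ) : ℂ) - Complex.I * t) := by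
        push_cast
        linear_combination (-(t : ℂ)) * Complex.I_sq
      have h4 : -Complex.I ≠ 0 := neg_ne_zero.2 Complex.I_ne_zero
      rw [h3, ← mul_div_assoc, div_eq_div_iff (mul_ne_zero h4 h2) h2]
      linear_combination (f t) * (((-y : ℝ) : ℂ) - Complex.I * t) * Complex.I_sq
    unfold cauchyTransform
    simp_rw [h1]
    rw [integral_const_mul, h]
    have hm : ProbabilityTheory.mgf (fun x : ℝ => -x) (σ.restrict (Iio 0)) y =
        ∫ x in Iio 0, Real.exp (-y * x) ∂σ := by
      unfold ProbabilityTheory.mgf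
      congr 1
      ext x
      ring_nf
    rw [hm]
    have hpi : (Real.pi : ℂ) ≠ 0 := by exact_mod_cast Real.pi_ne_zero
    push_cast
    field_simp
    rw [Complex.I_sq]
    ring
  have hsub : Iio (0 : ℝ) ⊆
      interior (ProbabilityTheory.integrableExpSet (fun x : ℝ => -x) (σ.restrict (Iio 0))) := by
    refine interior_maximal ?_ isOpen_Iio
    intro y hy
    have hy' : y < 0 := hy
    show Integrable _ _
    refine Integrable.mono' (integrable_const 1)
      (by apply Continuous.aestronglyMeasurable; fun_prop) ?_
    filter_upwards [ae_restrict_mem measurableSet_Iio] with x hx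
    have hx' : x < 0 := hx
    rw [Real.norm_of_nonneg (Real.exp_pos _).le]
    exact Real.exp_le_one_iff.2 (by nlinarith)
  have heq : EqOn (fun y : ℝ => (-(cauchyTransform f (Complex.I * y))).re)
      (fun y => 2 * ProbabilityTheory.mgf (fun x : ℝ => -x) (σ.restrict (Iio 0)) y) (Iio 0) := by
    intro y hy
    show (-(cauchyTransform f (Complex.I * y))).re = _
    rw [hk y hy, Complex.ofReal_re]
  refine ⟨fun y hy => by rw [hk y hy, Complex.ofReal_im], ?_, ?_⟩
  · refine ContDiffOn.congr ?_ heq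
    refine contDiffOn_const.mul ?_
    exact (ProbabilityTheory.analyticOn_mgf.mono hsub).contDiffOn (uniqueDiffOn_Iio 0)
  · intro n y hy
    rw [Filter.EventuallyEq.iteratedDeriv_eq n (heq.eventuallyEq_of_mem (Iio_mem_nhds hy)),
      iteratedDeriv_const_mul_field, ProbabilityTheory.iteratedDeriv_mgf (hsub hy)]
    refine mul_nonneg (by norm_num) (integral_nonneg_of_ae ?_)
    filter_upwards [ae_restrict_mem measurableSet_Iio] with x hx
    have hx' : x < 0 := hx
    have : 0 ≤ -x := by linarith
    show 0 ≤ (-x) ^ n * Real.exp (y * -x)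
    positivity
end

section
/- Let f : ℝ → ℂ be a bounded continuous function with f(0) = 1 satisfying ∫ℝ |f(t)|/(1 + |t|) dt < ∞, and let k_f denote its Cauchy transform. If y ↦ k_f(iy) is real-valued and completely monotonic on (0, ∞) and y ↦ −k_f(iy) is real-valued and absolutely monotonic on (−∞, 0), then f is a characteristic function. -/
open MeasureTheory Complex Set
open scoped ENNReal ComplexOrder

open Filter Topology

lemma levy_prob (μ : ℕ → ProbabilityMeasure ℝ) (g : ℝ → ℂ) (hg : ContinuousAt g 0)
    (h : ∀ t, Tendsto (fun n => charFun (μ n : Measure ℝ) t) atTop (𝓝 (g t))) :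
    ∃ μ₀ : ProbabilityMeasure ℝ, ∀ t, charFun (μ₀ : Measure ℝ) t = g t := by
  have ht : IsTightMeasureSet (Set.range (fun n => (μ n : Measure ℝ))) :=
    isTightMeasureSet_of_tendsto_charFun hg h
  have h_compact : IsCompact (closure (Set.range μ)) :=
    isCompact_closure_of_isTightMeasureSet (by
      convert ht using 1
      ext x; simp)
  obtain ⟨μ', -, hμ'⟩ := h_compact.ultrafilter_le_nhds ((hyperfilter ℕ).map μ)
    (by
      refine le_trans ?_ (monotone_principal subset_closure)
      simp)
  have hμ'' : Tendsto μ (hyperfilter ℕ : Filter ℕ) (𝓝 μ') := hμ'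
  refine ⟨μ', fun t => ?_⟩
  rw [ProbabilityMeasure.tendsto_iff_forall_integral_rclike_tendsto ℂ] at hμ''
  have h1 := hμ'' (BoundedContinuousFunction.innerProbChar t)
  simp_rw [← charFun_eq_integral_innerProbChar] at h1
  exact tendsto_nhds_unique h1 ((h t).mono_left (by
    rw [← Nat.cofinite_eq_atTop]; exact hyperfilter_le_cofinite))

def IsFC (g : ℝ → ℂ) : Prop :=
  ∃ μ : Measure ℝ, IsFiniteMeasure μ ∧ ∀ t, charFun μ t = g t

lemma IsFC.add {g h : ℝ → ℂ} (hg : IsFC g) (hh : IsFC h) : IsFC (fun t => g t + h t) := by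
  obtain ⟨μ, hμ, h1⟩ := hg
  obtain ⟨ν, hν, h2⟩ := hh
  refine ⟨μ + ν, inferInstance, fun t => ?_⟩
  beta_reduce
  rw [← h1, ← h2]
  simp only [charFun_apply]
  refine integral_add_measure ?_ ?_
  all_goals
    refine (integrable_const (1 : ℝ)).mono' (by fun_prop) (ae_of_all _ fun x => ?_)
    rw [Complex.norm_exp_ofReal_mul_I]

lemma IsFC.neg {g : ℝ → ℂ} (hg : IsFC g) : IsFC (fun t => g (-t)) := by
  obtain ⟨μ, hμ, h1⟩ := hg
  refine ⟨μ.map (fun x => -x), inferInstance, fun t => ?_⟩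
  beta_reduce
  rw [← h1]
  simp only [charFun_apply]
  rw [integral_map (by fun_prop) (by fun_prop)]
  simp

lemma IsFC.sum (c p : ℕ → ℝ) (hc : ∀ n, 0 ≤ c n) (hs : Summable c) (g : ℝ → ℂ)
    (hg : ∀ x : ℝ, HasSum (fun n => (c n : ℂ) * Complex.exp (x * p n * Complex.I)) (g x)) :
    IsFC g := by
  have hf : IsFiniteMeasure (Measure.sum fun n => ENNReal.ofReal (c n) • Measure.dirac (p n)) := by
    constructor
    rw [Measure.sum_apply _ MeasurableSet.univ]
    simp only [Measure.smul_apply, measure_univ, smul_eq_mul, mul_one]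
    rw [← ENNReal.ofReal_tsum_of_nonneg hc hs]
    exact ENNReal.ofReal_lt_top
  refine ⟨_, hf, fun x => ?_⟩
  rw [charFun_apply_real]
  have hi : Integrable (fun y : ℝ => Complex.exp (x * y * Complex.I))
    (Measure.sum fun n => ENNReal.ofReal (c n) • Measure.dirac (p n)) := by
    refine (integrable_const (1 : ℝ)).mono' (by fun_prop) (ae_of_all _ fun y => ?_)
    rw [← Complex.ofReal_mul, Complex.norm_exp_ofReal_mul_I]
  have := hasSum_integral_measure hi
  simp only [integral_smul_measure, integral_dirac, ENNReal.toReal_ofReal (hc _),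
    Complex.real_smul] at this
  exact this.unique (hg x)

lemma IsFC.lim (gn : ℕ → ℝ → ℂ) (hn : ∀ n, IsFC (gn n)) (g : ℝ → ℂ) (hg : Continuous g)
    (h0 : g 0 ≠ 0) (h : ∀ t, Tendsto (fun n => gn n t) atTop (𝓝 (g t))) :
    ∃ μ₀ : ProbabilityMeasure ℝ, ∀ t, charFun (μ₀ : Measure ℝ) t = g t / g 0 := by
  obtain ⟨N, hN⟩ := eventually_atTop.1 ((h 0).eventually_ne h0)
  choose μ hμ hμg using hn
  have hz : ∀ n, μ (n + N) ≠ 0 := by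
    intro n hh
    apply hN (n + N) (by omega)
    rw [← hμg, hh]; simp [charFun_apply]
  have hp : ∀ n, IsProbabilityMeasure ((μ (n + N) univ)⁻¹ • μ (n + N)) := by
    intro n
    have : NeZero (μ (n + N)) := ⟨hz n⟩
    infer_instance
  refine levy_prob (fun n => ⟨_, hp n⟩) (fun t => g t / g 0) (by fun_prop) fun t => ?_
  have := ((h t).div (h 0) h0).comp (tendsto_add_atTop_nat N)
  refine this.congr fun n => ?_
  simp only [Function.comp, ProbabilityMeasure.coe_mk, Pi.div_apply]
  rw [← hμg, ← hμg, charFun_zero, charFun_apply, charFun_apply, integral_smul_measure,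
    Complex.real_smul, ENNReal.toReal_inv, div_eq_inv_mul, Measure.real, Complex.ofReal_inv]

lemma iter_real (F : ℂ → ℂ) (hF : DifferentiableOn ℂ F {w | 0 < w.re}) (ω : ℝ → ℝ)
    (hω : ∀ y : ℝ, 0 < y → F y = ω y) (n : ℕ) :
    ∀ y : ℝ, 0 < y → iteratedDeriv n F y = (iteratedDeriv n ω y : ℝ) := by
  have ho : IsOpen {w : ℂ | 0 < w.re} := isOpen_lt continuous_const Complex.continuous_re
  induction n with
  | zero => simpa using hω
  | succ n ih =>
    intro y hy
    have hd : DifferentiableAt ℂ (iteratedDeriv n F) (y : ℂ) := by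
      have han : AnalyticAt ℂ F (y : ℂ) := hF.analyticAt (ho.mem_nhds (by simpa using hy))
      rw [iteratedDeriv_eq_iterate]
      exact (han.iterated_deriv n).differentiableAt
    have h1 := hd.hasDerivAt.comp_ofReal
    rw [← iteratedDeriv_succ] at h1
    have h2 : HasDerivAt (fun x : ℝ => ((iteratedDeriv n ω x : ℝ) : ℂ))
        (iteratedDeriv (n + 1) F y) y := by
      refine h1.congr_of_eventuallyEq ?_
      filter_upwards [lt_mem_nhds hy] with x hx
      exact (ih x hx).symm
    have h3 : HasDerivAt (iteratedDeriv n ω) (iteratedDeriv (n + 1) F y).re y := by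
      exact (Complex.reCLM.hasFDerivAt.comp_hasDerivAt y h2)
    have h4 := h3.ofReal_comp.unique h2
    rw [iteratedDeriv_succ (f := ω), h3.deriv, h4]

lemma approx_mem (a : ℝ) (ha : 0 < a) (w : ℂ) (hw : 0 < w.re) :
    (a * (1 - Complex.exp (-w / a)) : ℂ) ∈ Metric.ball (a : ℂ) a := by
  rw [Metric.mem_ball, dist_eq_norm]
  have : (a * (1 - Complex.exp (-w / a)) - a : ℂ) = -(a * Complex.exp (-w / a)) := by ring
  rw [this, norm_neg, norm_mul, Complex.norm_exp, Complex.norm_real, Real.norm_of_nonneg ha.le,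
    Complex.div_ofReal_re]
  have : Real.exp ((-w).re / a) < 1 := by
    rw [Real.exp_lt_one_iff]
    exact div_neg_of_neg_of_pos (by simpa using hw) ha
  nlinarith

lemma ball_sub_rhp (a : ℝ) : Metric.ball (a : ℂ) a ⊆ {w : ℂ | 0 < w.re} := by
  intro w hw
  rw [Metric.mem_ball, dist_eq_norm] at hw
  have := (Complex.abs_re_le_norm (w - a)).trans_lt hw
  rw [abs_lt] at this
  simp at this ⊢
  linarith

lemma cm_approx (F : ℂ → ℂ) (hF : DifferentiableOn ℂ F {w | 0 < w.re}) (ω : ℝ → ℝ)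
    (hω : ∀ y : ℝ, 0 < y → F y = ω y)
    (hcm : ∀ n : ℕ, ∀ y : ℝ, 0 < y → 0 ≤ (-1 : ℝ) ^ n * iteratedDeriv n ω y)
    (a : ℝ) (ha : 0 < a) (y : ℝ) (hy : 0 < y) :
    IsFC (fun x : ℝ => F (a * (1 - Complex.exp (-(y - x * Complex.I) / a)))) := by
  have key : ∀ x : ℝ, HasSum (fun n : ℕ =>
      (((n.factorial : ℝ)⁻¹ * a ^ n * Real.exp (-y / a) ^ n *
        ((-1 : ℝ) ^ n * iteratedDeriv n ω a) : ℝ) : ℂ) *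
        Complex.exp (x * ((n / a : ℝ) : ℂ) * Complex.I))
      (F (a * (1 - Complex.exp (-(y - x * Complex.I) / a)))) := by
    intro x
    have := Complex.hasSum_taylorSeries_on_ball (hF.mono (ball_sub_rhp a))
      (approx_mem a ha (y - x * Complex.I) (by simpa using hy))
    refine this.congr_fun ?_ 
    intro n
    rw [iter_real F hF ω hω n a ha]
    have e1 : (a * (1 - Complex.exp (-(y - x * Complex.I) / a)) - a : ℂ)
      = (-1) * a * Complex.exp (-y / a) * Complex.exp (x * Complex.I / a) := by
      rw [mul_assoc, ← Complex.exp_add]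
      rw [show (-y / a + x * Complex.I / a : ℂ) = -(y - x * Complex.I) / a by ring]
      ring
    have e2 : Complex.exp (x * ((n / a : ℝ) : ℂ) * Complex.I)
       = Complex.exp (x * Complex.I / a) ^ n := by
      rw [← Complex.exp_nat_mul]
      congr 1
      push_cast
      ring
    rw [e1, e2]
    simp only [smul_eq_mul, mul_pow]
    push_cast
    ring
  refine IsFC.sum _ (fun n => n / a) ?_ ?_ _ key
  · intro n
    have := hcm n a ha
    positivity
  · have := (key 0).summable
    simp only [Complex.ofReal_zero, zero_mul, Complex.exp_zero, mul_one] at this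
    exact_mod_cast this

lemma approx_tendsto (w : ℂ) :
    Tendsto (fun n : ℕ => (((n + 1 : ℕ) : ℝ) * (1 - Complex.exp (-w / ((n + 1 : ℕ) : ℝ))) : ℂ))
      atTop (𝓝 w) := by
  have h1 : HasDerivAt (fun s : ℂ => - Complex.exp (-w * s)) w 0 := by
    refine ((((hasDerivAt_id' (0 : ℂ)).const_mul (-w)).cexp).neg).congr_deriv ?_
    simp
  have h2 := h1.tendsto_slope_zero
  have h3 : Tendsto (fun n : ℕ => (((n + 1 : ℕ) : ℂ))⁻¹) atTop (𝓝[≠] 0) := by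
    rw [tendsto_nhdsWithin_iff]
    refine ⟨?_, Eventually.of_forall fun n => ?_⟩
    · have := (tendsto_one_div_add_atTop_nhds_zero_nat (𝕜 := ℂ))
      simpa using this
    · simp only [mem_compl_iff, mem_singleton_iff, inv_eq_zero]
      exact_mod_cast Nat.succ_ne_zero n
  refine (h2.comp h3).congr fun n => ?_
  simp only [Function.comp, inv_inv, smul_eq_mul, zero_add, mul_zero, Complex.exp_zero,
    Complex.ofReal_natCast, div_eq_mul_inv]
  ring

lemma ker_bound (z₀ : ℂ) (h : z₀.im ≠ 0) : ∃ C : ℝ, 0 < C ∧ ∀ z ∈ Metric.ball z₀ (|z₀.im| / 2),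
    z.im ≠ 0 ∧ ∀ t : ℝ, ‖(z - t)⁻¹‖ ≤ C / (1 + |t|) ∧ ‖(z - t)⁻¹‖ ≤ 2 / |z₀.im| := by
  have hr : 0 < |z₀.im| := abs_pos.2 h
  refine ⟨(1 + ‖z₀‖ + |z₀.im| / 2) / (|z₀.im| / 2) + 1, by positivity, fun z hz => ?_⟩
  rw [Metric.mem_ball, dist_eq_norm] at hz
  have h1 : |z₀.im| / 2 < |z.im| := by
    have h2 := (Complex.abs_im_le_norm (z - z₀)).trans_lt hz
    rw [Complex.sub_im] at h2
    have := abs_sub_abs_le_abs_sub z₀.im z.im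
    rw [abs_sub_comm] at this
    linarith
  have h0 : z.im ≠ 0 := by
    intro hh; rw [hh] at h1; simp at h1; linarith
  refine ⟨h0, fun t => ?_⟩
  have h3 : |z₀.im| / 2 < ‖z - t‖ := by
    have := Complex.abs_im_le_norm (z - t)
    simp at this
    linarith
  have h4 : ‖z‖ ≤ ‖z₀‖ + |z₀.im| / 2 := by
    have := norm_sub_norm_le z z₀
    linarith
  have h5 : |t| ≤ ‖z‖ + ‖z - t‖ := by
    have := norm_sub_le z (z - t)
    simpa using this
  have hp : 0 < ‖z - t‖ := by linarith
  rw [norm_inv]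
  constructor
  · rw [inv_eq_one_div, div_le_div_iff₀ hp (by positivity)]
    have : (1 + ‖z₀‖ + |z₀.im| / 2) ≤ (1 + ‖z₀‖ + |z₀.im| / 2) / (|z₀.im| / 2) * ‖z - t‖ := by
      rw [div_mul_eq_mul_div, le_div_iff₀ (by positivity)]
      exact mul_le_mul_of_nonneg_left h3.le (by positivity)
    linarith
  · rw [inv_eq_one_div, div_le_div_iff₀ hp hr]
    linarith

lemma sub_ne (z : ℂ) (h : z.im ≠ 0) (t : ℝ) : z - t ≠ 0 := by
  intro hh
  apply h
  have := congrArg Complex.im hh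
  simpa using this

lemma ker_int (f : ℝ → ℂ) (hc : Continuous f)
    (hint : Integrable (fun t : ℝ => ‖f t‖ / (1 + |t|))) (z : ℂ) (h : z.im ≠ 0) :
    Integrable (fun t : ℝ => f t / (z - t)) := by
  obtain ⟨C, hC, hb⟩ := ker_bound z h
  refine (hint.const_mul C).mono' ?_ (ae_of_all _ fun t => ?_)
  · exact (hc.div (by fun_prop) (sub_ne z h)).aestronglyMeasurable
  · have := ((hb z (Metric.mem_ball_self (by positivity))).2 t).1
    rw [div_eq_mul_inv, norm_mul]
    calc _ ≤ ‖f t‖ * (C / (1 + |t|)) := by gcongr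
      _ = _ := by ring

lemma cauchy_diff (f : ℝ → ℂ) (hc : Continuous f)
    (hint : Integrable (fun t : ℝ => ‖f t‖ / (1 + |t|))) (z : ℂ) (h : z.im ≠ 0) :
    DifferentiableAt ℂ (cauchyTransform f) z := by
  obtain ⟨C, hC, hb⟩ := ker_bound z h
  unfold cauchyTransform
  refine DifferentiableAt.const_mul ?_ _
  have hpos : 0 < |z.im| / 2 := by positivity
  refine (hasDerivAt_integral_of_dominated_loc_of_deriv_le (F := fun z t => f t / (z - (t : ℂ)))
    (F' := fun z (t : ℝ) => f t * (-((z - (t : ℂ))⁻¹) ^ 2))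
    (bound := fun t => (2 / |z.im| * C) * (‖f t‖ / (1 + |t|)))
    (Metric.ball_mem_nhds z hpos) ?_ (ker_int f hc hint z h) ?_ ?_ (hint.const_mul _)
    ?_).2.differentiableAt
  · filter_upwards [Metric.ball_mem_nhds z hpos] with w hw
    exact (ker_int f hc hint w (hb w hw).1).aestronglyMeasurable
  · refine Continuous.aestronglyMeasurable ?_
    have : Continuous fun t : ℝ => (z - (t : ℂ))⁻¹ := Continuous.inv₀ (by fun_prop) (sub_ne z h)
    fun_prop
  · refine ae_of_all _ fun t w hw => ?_
    have h1 := ((hb w hw).2 t).1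
    have h2 := ((hb w hw).2 t).2
    rw [norm_mul, norm_neg, norm_pow, sq]
    calc _ ≤ ‖f t‖ * ((2 / |z.im|) * (C / (1 + |t|))) := by gcongr
      _ = _ := by ring
  · refine ae_of_all _ fun t w hw => ?_
    simp only [div_eq_mul_inv]
    refine ((((hasDerivAt_id' w).sub_const (t : ℂ)).inv
      (sub_ne w (hb w hw).1 t)).const_mul (f t)).congr_deriv ?_
    simp only [div_eq_mul_inv, inv_pow, neg_mul, one_mul]

noncomputable def pois (f : ℝ → ℂ) (y x : ℝ) : ℂ :=
  (cauchyTransform f (x + y * Complex.I) - cauchyTransform f (x - y * Complex.I)) / 2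

lemma pois_eq (f : ℝ → ℂ) (hc : Continuous f)
    (hint : Integrable (fun t : ℝ => ‖f t‖ / (1 + |t|))) (y x : ℝ) (hy : 0 < y) :
    pois f y x = (Real.pi : ℂ)⁻¹ * ∫ s : ℝ, f (x + y * s) * (((1 + s ^ 2)⁻¹ : ℝ) : ℂ) := by
  have i1 : ((x : ℂ) + y * Complex.I).im ≠ 0 := by simp [hy.ne']
  have i2 : ((x : ℂ) - y * Complex.I).im ≠ 0 := by simp [hy.ne']
  have hpi : (Real.pi : ℂ) ≠ 0 := by exact_mod_cast Real.pi_ne_zero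
  unfold pois cauchyTransform
  rw [← mul_sub, ← integral_sub (ker_int f hc hint _ i1) (ker_int f hc hint _ i2)]
  have e : ∀ t : ℝ, f t / (((x : ℂ) + y * Complex.I) - t) - f t / (((x : ℂ) - y * Complex.I) - t)
      = (-2 * Complex.I) * (f t * ((y / ((t - x) ^ 2 + y ^ 2) : ℝ) : ℂ)) := by
    intro t
    have n1 := sub_ne _ i1 t
    have n2 := sub_ne _ i2 t
    have n3 : (((t : ℂ) - x) ^ 2 + y ^ 2) ≠ 0 := by
      have : ((t - x) ^ 2 + y ^ 2) ≠ 0 := by positivity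
      exact_mod_cast this
    have n4 : (((x : ℂ) + y * Complex.I) - t) * (((x : ℂ) - y * Complex.I) - t)
        = (((t : ℂ) - x) ^ 2 + y ^ 2) := by
      ring_nf; rw [Complex.I_sq]; ring
    rw [div_sub_div _ _ n1 n2, n4]
    push_cast
    field_simp
    ring
  simp_rw [e]
  rw [integral_const_mul]
  rw [← integral_add_left_eq_self _ x]
  have := Measure.integral_comp_mul_left
    (fun u : ℝ => f (x + u) * ((y / ((x + u - x) ^ 2 + y ^ 2) : ℝ) : ℂ)) y
  have e2 : ∫ s : ℝ, f (x + y * s) * (((1 + s ^ 2)⁻¹ : ℝ) : ℂ) = 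
     ∫ s : ℝ, y * (f (x + y * s) * ((y / ((x + y * s - x) ^ 2 + y ^ 2) : ℝ) : ℂ)) := by
    congr 1
    ext s
    have : (1 + s ^ 2)⁻¹ = y * (y / ((x + y * s - x) ^ 2 + y ^ 2)) := by
      have : 1 + s ^ 2 ≠ 0 := by positivity
      have : (x + y * s - x) ^ 2 + y ^ 2 ≠ 0 := by positivity
      field_simp
      ring
    rw [this]
    push_cast
    ring
  rw [e2, integral_const_mul, this, abs_of_pos (inv_pos.2 hy), Complex.real_smul]
  have hy' : (y : ℂ) ≠ 0 := by exact_mod_cast hy.ne'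
  rw [Complex.ofReal_inv, mul_inv_cancel_left₀ hy']
  field_simp
  rw [Complex.I_sq]
  ring

lemma pois_tendsto (f : ℝ → ℂ) (hc : Continuous f) (hb : ∃ M : ℝ, ∀ x : ℝ, ‖f x‖ ≤ M)
    (hint : Integrable (fun t : ℝ => ‖f t‖ / (1 + |t|))) (x : ℝ) :
    Tendsto (fun y => pois f y x) (𝓝[>] 0) (𝓝 (f x)) := by
  obtain ⟨M, hM⟩ := hb
  have hpi : (Real.pi : ℂ) ≠ 0 := by exact_mod_cast Real.pi_ne_zero
  have : Tendsto (fun y : ℝ => (Real.pi : ℂ)⁻¹ * ∫ s : ℝ, f (x + y * s) * (((1 + s ^ 2)⁻¹ : ℝ) : ℂ))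
      (𝓝[>] 0) (𝓝 ((Real.pi : ℂ)⁻¹ * ∫ s : ℝ, f x * (((1 + s ^ 2)⁻¹ : ℝ) : ℂ))) := by
    refine Tendsto.const_mul _ ?_
    refine tendsto_integral_filter_of_dominated_convergence (fun s => M * (1 + s ^ 2)⁻¹) ?_ ?_ ?_ ?_
    · refine Eventually.of_forall fun y => Continuous.aestronglyMeasurable ?_
      have : Continuous fun s : ℝ => (1 + s ^ 2)⁻¹ :=
        Continuous.inv₀ (by fun_prop) (fun s => by positivity)
      fun_prop
    · refine Eventually.of_forall fun y => ae_of_all _ fun s => ?_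
      have h0 : 0 ≤ (1 + s ^ 2)⁻¹ := by positivity
      rw [norm_mul, Complex.norm_real, Real.norm_of_nonneg h0]
      exact mul_le_mul_of_nonneg_right (hM _) h0
    · exact integrable_inv_one_add_sq.const_mul M
    · refine ae_of_all _ fun s => ?_
      have h1 : Continuous fun y : ℝ => f (x + y * s) * (((1 + s ^ 2)⁻¹ : ℝ) : ℂ) := by fun_prop
      have := (h1.tendsto 0).mono_left (nhdsWithin_le_nhds (s := Ioi 0))
      simpa using this
  rw [integral_const_mul, integral_complex_ofReal, integral_univ_inv_one_add_sq] at this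
  rw [show (Real.pi : ℂ)⁻¹ * (f x * Real.pi) = f x by field_simp] at this
  refine this.congr' ?_
  filter_upwards [self_mem_nhdsWithin] with y hy
  rw [pois_eq f hc hint y x hy]

lemma pois_char (f : ℝ → ℂ) (hc : Continuous f)
    (hint : Integrable (fun t : ℝ => ‖f t‖ / (1 + |t|)))
    (hre : ∀ y ∈ Ioi (0 : ℝ), (cauchyTransform f (Complex.I * y)).im = 0)
    (hcm : CompletelyMonotonicOn (fun y : ℝ => (cauchyTransform f (Complex.I * y)).re) (Ioi 0))
    (hre' : ∀ y ∈ Iio (0 : ℝ), (-(cauchyTransform f (Complex.I * y))).im = 0)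
    (ham : AbsolutelyMonotonicOn
      (fun y : ℝ => (-(cauchyTransform f (Complex.I * y))).re) (Iio 0))
    (y : ℝ) (hy : 0 < y) (h0 : pois f y 0 ≠ 0) :
    ∃ μ₀ : ProbabilityMeasure ℝ, ∀ t, charFun (μ₀ : Measure ℝ) t = pois f y t / pois f y 0 := by
  set F : ℂ → ℂ := fun w => cauchyTransform f (Complex.I * w) with hFdef
  set G : ℂ → ℂ := fun w => -cauchyTransform f (Complex.I * (-w)) with hGdef
  have hF : ∀ w : ℂ, 0 < w.re → DifferentiableAt ℂ F w := by
    intro w hw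
    have : DifferentiableAt ℂ (cauchyTransform f) (Complex.I * w) :=
      cauchy_diff f hc hint _ (by simpa using hw.ne')
    exact this.comp w (by fun_prop)
  have hG : ∀ w : ℂ, 0 < w.re → DifferentiableAt ℂ G w := by
    intro w hw
    have : DifferentiableAt ℂ (cauchyTransform f) (Complex.I * (-w)) :=
      cauchy_diff f hc hint _ (by simpa using hw.ne')
    exact (this.comp w (f := fun w => Complex.I * (-w)) (by fun_prop)).neg
  have aF : ∀ a : ℝ, 0 < a → IsFC (fun x : ℝ =>
      F (a * (1 - Complex.exp (-(y - x * Complex.I) / a)))) := by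
    intro a ha
    refine cm_approx F (fun w hw => (hF w hw).differentiableWithinAt)
      (fun y : ℝ => (cauchyTransform f (Complex.I * y)).re) ?_ (fun n y hy => hcm.2 n y hy)
      a ha y hy
    intro u hu
    exact Complex.ext (by simp [hFdef]) (by simpa [hFdef] using hre u hu)
  have aG : ∀ a : ℝ, 0 < a → IsFC (fun x : ℝ =>
      G (a * (1 - Complex.exp (-(y - x * Complex.I) / a)))) := by
    intro a ha
    refine cm_approx G (fun w hw => (hG w hw).differentiableWithinAt)
      (fun y : ℝ => (fun y : ℝ => (-(cauchyTransform f (Complex.I * y))).re) (-y)) ?_ ?_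
      a ha y hy
    · intro u hu
      have := hre' (-u) (by simpa using hu)
      exact Complex.ext (by simp [hGdef]) (by simpa [hGdef] using this)
    · intro n u hu
      rw [iteratedDeriv_comp_neg n (fun y : ℝ => (-(cauchyTransform f (Complex.I * y))).re) u,
        smul_eq_mul, ← mul_assoc, ← mul_pow]
      have := ham.2 n (-u) (by simpa using hu)
      simpa using this
  have hsum : ∀ x : ℝ, F (y - x * Complex.I) + G (y - (-x : ℝ) * Complex.I) = 2 * pois f y x := by
    intro x
    have e1 : Complex.I * (y - x * Complex.I) = x + y * Complex.I := by
      ring_nf; rw [Complex.I_sq]; ring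
    have e2 : Complex.I * -(y - (-x : ℝ) * Complex.I) = x - y * Complex.I := by
      push_cast; ring_nf; rw [Complex.I_sq]; ring
    simp only [hFdef, hGdef, e1, e2, pois]
    ring
  have hre1 : ∀ x : ℝ, 0 < ((y : ℂ) - x * Complex.I).re := by
    intro x; simpa using hy
  have hcont : Continuous fun x : ℝ => F (y - x * Complex.I) + G (y - (-x : ℝ) * Complex.I) := by
    rw [continuous_iff_continuousAt]
    intro x
    refine ContinuousAt.add ?_ ?_
    · exact ContinuousAt.comp (f := fun x : ℝ => ((y : ℂ) - x * Complex.I))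
        (hF _ (hre1 x)).continuousAt (by fun_prop)
    · exact ContinuousAt.comp (f := fun x : ℝ => ((y : ℂ) - (-x : ℝ) * Complex.I))
        (hG _ (hre1 (-x))).continuousAt (by fun_prop)
  have key := IsFC.lim _ (fun n : ℕ => (aF ((n + 1 : ℕ) : ℝ) (by positivity)).add
    (aG ((n + 1 : ℕ) : ℝ) (by positivity)).neg) _ hcont
    (by rw [hsum]; exact mul_ne_zero two_ne_zero h0) (by
      intro x
      refine Tendsto.add ?_ ?_
      · exact ((hF _ (hre1 x)).continuousAt.tendsto.comp (approx_tendsto _))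
      · exact ((hG _ (hre1 (-x))).continuousAt.tendsto.comp (approx_tendsto _)))
  obtain ⟨μ₀, hμ⟩ := key
  refine ⟨μ₀, fun t => ?_⟩
  rw [hμ, hsum, hsum, mul_div_mul_left _ _ two_ne_zero]

/-- Sufficiency part of Theorem 3: if `k_f(iy)` is real-valued completely monotonic on
`(0,∞)` and `-k_f(iy)` is real-valued absolutely monotonic on `(-∞,0)`, then `f` is a
characteristic function. -/
theorem stmt_5 (f : ℝ → ℂ) (hc : Continuous f) (hb : ∃ M : ℝ, ∀ x : ℝ, ‖f x‖ ≤ M)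
    (h0 : f 0 = 1) (hint : Integrable (fun t : ℝ => ‖f t‖ / (1 + |t|)))
    (hre : ∀ y ∈ Ioi (0 : ℝ), (cauchyTransform f (Complex.I * y)).im = 0)
    (hcm : CompletelyMonotonicOn (fun y : ℝ => (cauchyTransform f (Complex.I * y)).re) (Ioi 0))
    (hre' : ∀ y ∈ Iio (0 : ℝ), (-(cauchyTransform f (Complex.I * y))).im = 0)
    (ham : AbsolutelyMonotonicOn
      (fun y : ℝ => (-(cauchyTransform f (Complex.I * y))).re) (Iio 0)) :
    IsCharFun f := by
  obtain ⟨N, hN⟩ : ∃ N : ℕ, ∀ n : ℕ, N ≤ n → pois f (1 / ((n : ℝ) + 1)) 0 ≠ 0 := by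
    have h1 : ∀ᶠ y in 𝓝[>] (0 : ℝ), pois f y 0 ≠ 0 :=
      (pois_tendsto f hc hb hint 0).eventually_ne (by rw [h0]; exact one_ne_zero)
    have h2 : Tendsto (fun n : ℕ => 1 / ((n : ℝ) + 1)) atTop (𝓝[>] 0) :=
      tendsto_nhdsWithin_iff.2 ⟨tendsto_one_div_add_atTop_nhds_zero_nat,
        Eventually.of_forall fun n => by simp only [mem_Ioi]; positivity⟩
    exact eventually_atTop.1 (h2.eventually h1)
  have h2 : Tendsto (fun n : ℕ => 1 / (((n + N : ℕ) : ℝ) + 1)) atTop (𝓝[>] 0) :=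
    tendsto_nhdsWithin_iff.2 ⟨(tendsto_one_div_add_atTop_nhds_zero_nat (𝕜 := ℝ)).comp
      (tendsto_add_atTop_nat N),
      Eventually.of_forall fun n => by simp only [mem_Ioi]; positivity⟩
  choose μ hμ using fun n : ℕ => pois_char f hc hint hre hcm hre' ham
    (1 / (((n + N : ℕ) : ℝ) + 1)) (by positivity) (hN (n + N) (by omega))
  obtain ⟨σ, hσ⟩ := levy_prob μ f hc.continuousAt (by
    intro t
    have := ((pois_tendsto f hc hb hint t).comp h2).div ((pois_tendsto f hc hb hint 0).comp h2)
      (by rw [h0]; exact one_ne_zero)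
    rw [h0, div_one] at this
    refine this.congr fun n => ?_
    rw [hμ]
    rfl)
  refine ⟨σ, inferInstance, fun x => ?_⟩
  rw [← hσ, charFun_apply_real]
  congr 1
  ext t
  congr 1
  ring
end

section
/- Let σ be a probability measure on ℝ, let f(x) = ∫ℝ e^{ixt} dσ(x') be the associated characteristic function (assumed bounded and continuous), let K_f be the modified Cauchy transform of f, and set a_f = ∫ℝ sign(x) e^{−|x|} dσ(x). Then for every y > 0, K_f(iy) + a_f = ∫_{[0,∞)} e^{−yx} dσ₁(x), where σ₁ is the nonnegative finite measure σ₁ = 2·σ restricted to [0, ∞) minus σ({0})·δ₀. In particular, y ↦ K_f(iy) + a_f is completely monotonic on (0, ∞). -/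
open MeasureTheory Complex Set
open scoped ENNReal ComplexOrder

noncomputable def hfun (y : ℝ) (x : ℝ) : ℂ :=
  if x ≤ 0 then Complex.exp (1 * x) else 2 * Complex.exp (-y * x) - Complex.exp (-1 * x)

noncomputable def gker (y : ℝ) (t : ℝ) : ℂ :=
  1 / (Complex.I * y - (t : ℂ)) + (t : ℂ) / ((t : ℂ) ^ 2 + 1)

lemma denom_ne {y : ℝ} (hy : 0 < y) (t : ℝ) : Complex.I * y - (t : ℂ) ≠ 0 := by
  intro h
  have := congrArg Complex.im h
  simp at this
  exact hy.ne' this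

lemma sq_add_one_ne (t : ℝ) : (t : ℂ) ^ 2 + 1 ≠ 0 := by
  have : (t ^ 2 + 1 : ℝ) ≠ 0 := by positivity
  exact_mod_cast this

lemma gker_cont {y : ℝ} (hy : 0 < y) : Continuous (gker y) := by
  unfold gker
  refine Continuous.add ?_ ?_
  · exact continuous_const.div (by fun_prop) (denom_ne hy)
  · exact Continuous.div (by fun_prop) (by fun_prop) sq_add_one_ne

lemma gker_bound {y : ℝ} (hy : 0 < y) (t : ℝ) :
    ‖gker y t‖ ≤ (y + 1 / y) * (1 + t ^ 2)⁻¹ := by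
  have e : gker y t = (1 + Complex.I * y * t) / (Complex.I * y - (t : ℂ)) * (((1 + t ^ 2)⁻¹ : ℝ) : ℂ) := by
    unfold gker
    have h1 := denom_ne hy t
    have h2 := sq_add_one_ne t
    have h3 : (1 : ℂ) + (t : ℂ) ^ 2 ≠ 0 := by rw [add_comm]; exact h2
    push_cast
    field_simp
    ring
  rw [e, norm_mul, Complex.norm_real, Real.norm_eq_abs, abs_of_pos (by positivity)]
  gcongr
  rw [norm_div, div_le_iff₀ (norm_pos_iff.2 (denom_ne hy t))]
  have hC : 0 < y + 1 / y := by positivity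
  refine abs_le_of_sq_le_sq' ?_ (by positivity) |>.2
  rw [mul_pow, ← Complex.normSq_eq_norm_sq, ← Complex.normSq_eq_norm_sq]
  simp only [Complex.normSq_apply]
  simp
  have h1 : y * y⁻¹ = 1 := mul_inv_cancel₀ hy.ne'
  have h2 : (y + y⁻¹) ^ 2 = y ^ 2 + 2 + y⁻¹ ^ 2 := by linear_combination 2 * h1
  have h3 : y⁻¹ ^ 2 * (y * y) = 1 := by linear_combination (y * y⁻¹ + 1) * h1
  rw [h2]
  nlinarith [sq_nonneg t, sq_nonneg y, sq_nonneg (y⁻¹ * t), sq_nonneg (y * y)]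

lemma gker_int {y : ℝ} (hy : 0 < y) : Integrable (gker y) :=
  (integrable_inv_one_add_sq.const_mul (y + 1 / y)).mono' (gker_cont hy).aestronglyMeasurable
    (Filter.Eventually.of_forall (gker_bound hy))

lemma hfun_cont (y : ℝ) : Continuous (hfun y) := by
  unfold hfun
  refine Continuous.if_le (by fun_prop) (by fun_prop) (by fun_prop) (by fun_prop) ?_
  intro x hx
  subst hx
  norm_num

lemma hfun_int {y : ℝ} (hy : 0 < y) : Integrable (hfun y) := by
  have h1 : IntegrableOn (hfun y) (Iic 0) := by
    refine (integrableOn_exp_mul_complex_Iic (a := 1) (by simp) 0).congr_fun ?_ measurableSet_Iic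
    intro x hx
    have hx : x ≤ 0 := hx
    simp [hfun, hx]
  have h2 : IntegrableOn (hfun y) (Ioi 0) := by
    have h3 : IntegrableOn (fun x : ℝ => 2 * Complex.exp (-(y : ℂ) * x) - Complex.exp (-1 * x))
        (Ioi 0) :=
      ((integrableOn_exp_mul_complex_Ioi (a := -(y : ℂ)) (by simpa) 0).const_mul 2).sub
        (integrableOn_exp_mul_complex_Ioi (a := -1) (by simp) 0)
    refine h3.congr_fun ?_ measurableSet_Ioi
    intro x hx
    have hx : ¬ x ≤ 0 := not_le.2 hx
    simp [hfun, hx]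
  have := h1.union h2
  rwa [Iic_union_Ioi, integrableOn_univ] at this

open FourierTransform in
lemma fourier_hfun {y : ℝ} (hy : 0 < y) (w : ℝ) :
    𝓕 (hfun y) w = 2 * Complex.I * gker y (2 * Real.pi * w) := by
  rw [Real.fourier_real_eq_integral_exp_smul]
  set t : ℝ := 2 * Real.pi * w with ht
  have key : ∀ v : ℝ, Complex.exp (↑(-2 * Real.pi * v * w) * Complex.I) • hfun y v
      = Complex.exp (-(Complex.I * t) * v) * hfun y v := by
    intro v
    rw [smul_eq_mul, ht]
    congr 2
    push_cast
    ring
  simp_rw [key]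
  have hcalc1 : ∀ v ∈ Iic (0 : ℝ), Complex.exp (-(Complex.I * t) * v) * hfun y v
      = Complex.exp ((1 - Complex.I * t) * v) := by
    intro v hv
    have hv : v ≤ 0 := hv
    simp only [hfun, hv, if_true]
    rw [← Complex.exp_add]
    ring_nf
  have hcalc2 : ∀ v ∈ Ioi (0 : ℝ), Complex.exp (-(Complex.I * t) * v) * hfun y v
      = 2 * Complex.exp ((-y - Complex.I * t) * v) - Complex.exp ((-1 - Complex.I * t) * v) := by
    intro v hv
    have hv : ¬ v ≤ 0 := not_le.2 hv
    simp only [hfun, hv, if_false]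
    rw [mul_sub, mul_left_comm, ← Complex.exp_add, ← Complex.exp_add]
    ring_nf
  have r1 : 0 < (1 - Complex.I * t : ℂ).re := by simp
  have r2 : (-y - Complex.I * t : ℂ).re < 0 := by simpa
  have r3 : (-1 - Complex.I * t : ℂ).re < 0 := by simp
  have hInt : Integrable (fun v : ℝ => Complex.exp (-(Complex.I * t) * v) * hfun y v) := by
    refine (hfun_int hy).bdd_mul (c := 1) (by fun_prop) (Filter.Eventually.of_forall ?_)
    intro v
    rw [Complex.norm_exp]
    simp
  rw [← intervalIntegral.integral_Iic_add_Ioi (b := 0) hInt.integrableOn hInt.integrableOn,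
    setIntegral_congr_fun measurableSet_Iic hcalc1, setIntegral_congr_fun measurableSet_Ioi hcalc2,
    integral_sub ((integrableOn_exp_mul_complex_Ioi r2 0).const_mul 2)
      (integrableOn_exp_mul_complex_Ioi r3 0), integral_const_mul,
    integral_exp_mul_complex_Ioi r2, integral_exp_mul_complex_Ioi r3,
    integral_exp_mul_complex_Iic r1]
  simp only [ofReal_zero, mul_zero, Complex.exp_zero, gker]
  have n1 : (1 - Complex.I * t : ℂ) ≠ 0 := fun h => by rw [h] at r1; simp at r1
  have n2 : (-y - Complex.I * t : ℂ) ≠ 0 := fun h => by rw [h] at r2; simp at r2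
  have n3 : (-1 - Complex.I * t : ℂ) ≠ 0 := fun h => by rw [h] at r3; simp at r3
  have n4 := denom_ne hy t
  have e1 : (Complex.I * y - t : ℂ) = -Complex.I * (-y - Complex.I * t) := by
    linear_combination -(t : ℂ) * Complex.I_sq
  have e2 : (t ^ 2 + 1 : ℂ) = -((1 - Complex.I * t) * (-1 - Complex.I * t)) := by
    linear_combination (t : ℂ) ^ 2 * Complex.I_sq
  rw [e1, e2]
  have hI := Complex.I_ne_zero
  field_simp
  ring

open FourierTransform in
lemma kernel_integral {y : ℝ} (hy : 0 < y) (x : ℝ) :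
    (Complex.I / (Real.pi : ℂ)) * ∫ t : ℝ, gker y t * Complex.exp (Complex.I * t * x)
      = hfun y x := by
  have hF : 𝓕 (hfun y) = fun w : ℝ => 2 * Complex.I * gker y (2 * Real.pi * w) :=
    funext (fourier_hfun hy)
  have hpi : (2 * Real.pi) ≠ 0 := by positivity
  have hFi : Integrable (𝓕 (hfun y)) := by
    rw [hF]
    exact ((gker_int hy).comp_mul_left' hpi).const_mul _
  have inv := congrFun ((hfun_cont y).fourierInv_fourier_eq (hfun_int hy) hFi) x
  rw [← inv, Real.fourierInv_eq', hF]
  have e : ∀ v : ℝ, Complex.exp (↑(2 * Real.pi * inner ℝ v x) * Complex.I) •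
      (2 * Complex.I * gker y (2 * Real.pi * v)) =
      (fun t : ℝ => 2 * Complex.I * (gker y t * Complex.exp (Complex.I * t * x)))
        (2 * Real.pi * v) := by
    intro v
    simp only [smul_eq_mul, RCLike.inner_apply, conj_trivial]
    have : ((2 * Real.pi * (x * v) : ℝ) : ℂ) * Complex.I
      = Complex.I * ((2 * Real.pi * v : ℝ) : ℂ) * x := by push_cast; ring
    rw [this]
    ring
  rw [integral_congr_ae (Filter.Eventually.of_forall e)]
  rw [Measure.integral_comp_mul_left
      (fun t : ℝ => 2 * Complex.I * (gker y t * Complex.exp (Complex.I * t * x))) (2 * Real.pi),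
    integral_const_mul, abs_of_pos (by positivity),
    Complex.real_smul]
  push_cast
  have : (Real.pi : ℂ) ≠ 0 := by exact_mod_cast Real.pi_ne_zero
  generalize (∫ t : ℝ, gker y t * Complex.exp (Complex.I * t * x)) = J
  field_simp

lemma modCauchy_eq (σ : Measure ℝ) [IsProbabilityMeasure σ] (f : ℝ → ℂ)
    (hf : ∀ x : ℝ, f x = ∫ t : ℝ, Complex.exp (Complex.I * x * t) ∂σ) {y : ℝ} (hy : 0 < y) :
    modCauchyTransform f (Complex.I * y) = ∫ x, hfun y x ∂σ := by
  have hInt : Integrable (Function.uncurry fun (t x : ℝ) =>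
      gker y t * Complex.exp (Complex.I * t * x)) (volume.prod σ) := by
    have h1 : Integrable (fun z : ℝ × ℝ => gker y z.1 * (1 : ℂ)) (volume.prod σ) :=
      (gker_int hy).mul_prod (integrable_const 1)
    simp only [mul_one] at h1
    refine h1.mul_bdd (c := 1) (Continuous.aestronglyMeasurable (by fun_prop))
      (Filter.Eventually.of_forall ?_)
    intro v
    rw [Complex.norm_exp]
    simp
  have := integral_integral_swap hInt
  simp_rw [← kernel_integral hy]
  rw [integral_const_mul, ← this]
  unfold modCauchyTransform
  congr 1
  refine integral_congr_ae (Filter.Eventually.of_forall ?_)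
  intro t
  simp only
  rw [hf, ← integral_const_mul]
  rfl

lemma sigma1_eq (σ : Measure ℝ) [IsProbabilityMeasure σ] :
    (2 : ℝ≥0∞) • σ.restrict (Ici 0) - σ {0} • Measure.dirac (0 : ℝ) =
      (2 : ℝ≥0∞) • σ.restrict (Ioi 0) + σ {0} • Measure.dirac (0 : ℝ) := by
  have h : σ.restrict (Ici 0) = σ.restrict (Ioi 0) + σ {0} • Measure.dirac (0 : ℝ) := by
    rw [← Measure.restrict_singleton, ← Measure.restrict_union (by simp) (by simp),
      Set.Ioi_union_left]
  have : IsFiniteMeasure (σ {0} • Measure.dirac (0 : ℝ)) := by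
    rw [← Measure.restrict_singleton]; infer_instance
  rw [h, smul_add, two_smul ℝ≥0∞ (σ {0} • Measure.dirac (0 : ℝ)), ← add_assoc,
    Measure.add_sub_cancel]

lemma main_eq (σ : Measure ℝ) [IsProbabilityMeasure σ] {y : ℝ} (hy : 0 < y) :
    (∫ x, hfun y x ∂σ) + ((∫ x : ℝ, Real.sign x * Real.exp (-|x|) ∂σ : ℝ) : ℂ) =
      ((∫ x in Ici (0 : ℝ), Real.exp (-y * x) ∂((2 : ℝ≥0∞) • σ.restrict (Ioi 0)
        + σ {0} • Measure.dirac (0 : ℝ)) : ℝ) : ℂ) := by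
  set k : ℝ → ℝ := fun x => (Ioi (0 : ℝ)).indicator (fun x => 2 * Real.exp (-y * x)) x
    + ({0} : Set ℝ).indicator (fun _ => 1) x with hk
  have ioi : IntegrableOn (fun x => Real.exp (-y * x)) (Ioi 0) σ := by
    refine Integrable.mono' (integrable_const 1) (by fun_prop) ?_
    refine (ae_restrict_iff' measurableSet_Ioi).2 (Filter.Eventually.of_forall ?_)
    intro x hx
    have hx : 0 < x := hx
    rw [Real.norm_eq_abs, abs_of_pos (Real.exp_pos _), Real.exp_le_one_iff]
    nlinarith
  have i1 : Integrable (fun x => (Ioi (0 : ℝ)).indicator (fun x => 2 * Real.exp (-y * x)) x) σ :=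
    IntegrableOn.integrable_indicator (ioi.const_mul 2) measurableSet_Ioi
  have i2 : Integrable (fun x => ({0} : Set ℝ).indicator (fun _ => (1 : ℝ)) x) σ :=
    (integrable_const 1).indicator (measurableSet_singleton 0)
  have ik : Integrable k σ := i1.add i2
  have is : Integrable (fun x : ℝ => Real.sign x * Real.exp (-|x|)) σ := by
    have ms : Measurable Real.sign := by
      unfold Real.sign
      exact Measurable.ite measurableSet_Iio measurable_const
        (Measurable.ite measurableSet_Ioi measurable_const measurable_const)
    refine Integrable.mono' (integrable_const 1)
      (ms.mul (by fun_prop)).aestronglyMeasurable (Filter.Eventually.of_forall ?_)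
    intro x
    rw [norm_mul, Real.norm_eq_abs, Real.norm_eq_abs, abs_of_pos (Real.exp_pos _)]
    have h1 : |Real.sign x| ≤ 1 := by
      rcases Real.sign_apply_eq x with h | h | h <;> simp [h]
    have h2 : Real.exp (-|x|) ≤ 1 := by simp
    nlinarith [Real.exp_pos (-|x|), abs_nonneg (Real.sign x)]
  have eh : ∀ x, hfun y x = ((k x - Real.sign x * Real.exp (-|x|) : ℝ) : ℂ) := by
    intro x
    rcases lt_trichotomy x 0 with h | h | h
    · have h1 : ¬ 0 < x := not_lt.2 h.le
      simp [hfun, hk, h.le, h.ne, h1, Real.sign_of_neg h, abs_of_neg h]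
    · subst h
      simp [hfun, hk]
    · simp [hfun, hk, not_le.2 h, h.ne', h, Real.sign_of_pos h, abs_of_pos h]
  simp_rw [eh]
  rw [integral_complex_ofReal, ← Complex.ofReal_add, integral_sub ik is, sub_add_cancel]
  congr 1
  have fin : IsFiniteMeasure (σ {0} • Measure.dirac (0 : ℝ)) := by
    rw [← Measure.restrict_singleton]; infer_instance
  have r1 : ((2 : ℝ≥0∞) • σ.restrict (Ioi 0)).restrict (Ici (0 : ℝ))
      = (2 : ℝ≥0∞) • σ.restrict (Ioi 0) := by
    rw [Measure.restrict_smul, Measure.restrict_restrict measurableSet_Ici]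
    congr 2
    exact inter_eq_right.2 Ioi_subset_Ici_self
  have r2 : (σ {0} • Measure.dirac (0 : ℝ)).restrict (Ici (0 : ℝ))
      = σ {0} • Measure.dirac (0 : ℝ) := by
    rw [Measure.restrict_smul, restrict_dirac' (by exact measurableSet_Ici)]
    simp
  rw [Measure.restrict_add, r1, r2, integral_add_measure, integral_smul_measure,
    integral_smul_measure, integral_dirac, hk, integral_add i1 i2,
    integral_indicator measurableSet_Ioi, integral_const_mul,
    integral_indicator (measurableSet_singleton 0)]
  · simp [Measure.real]
  · exact ioi.smul_measure (by simp)
  · rw [← Measure.restrict_singleton]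
    refine IntegrableOn.integrable ?_
    exact integrableOn_singleton (by simp)

open ProbabilityTheory in
lemma laplace_cm (μ : Measure ℝ) [IsFiniteMeasure μ] (φ : ℝ → ℝ)
    (h : ∀ y ∈ Ioi (0 : ℝ), φ y = ∫ x in Ici (0 : ℝ), Real.exp (-y * x) ∂μ) :
    CompletelyMonotonicOn φ (Ioi 0) := by
  set ν := μ.restrict (Ici (0 : ℝ)) with hν
  have hae : ∀ᵐ x ∂ν, 0 ≤ x := (ae_restrict_iff' measurableSet_Ici).2
    (Filter.Eventually.of_forall fun x hx => hx)
  have hsub : Ioi (0 : ℝ) ⊆ integrableExpSet (fun x : ℝ => -x) ν := by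
    intro y hy
    have hy : 0 < y := hy
    refine Integrable.mono' (integrable_const 1)
      (Continuous.aestronglyMeasurable (by fun_prop)) ?_
    filter_upwards [hae] with x hx
    rw [Real.norm_eq_abs, abs_of_pos (Real.exp_pos _), Real.exp_le_one_iff]
    nlinarith
  have hInt : Ioi (0 : ℝ) ⊆ interior (integrableExpSet (fun x : ℝ => -x) ν) :=
    interior_maximal hsub isOpen_Ioi
  have heq : EqOn φ (mgf (fun x : ℝ => -x) ν) (Ioi 0) := by
    intro y hy
    rw [h y hy, mgf]
    simp
  refine ⟨((analyticOn_mgf.mono hInt).contDiffOn (uniqueDiffOn_Ioi 0)).congr heq, ?_⟩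
  intro n y hy
  have hev : φ =ᶠ[nhds y] mgf (fun x : ℝ => -x) ν :=
    heq.eventuallyEq_of_mem (Ioi_mem_nhds hy)
  rw [hev.iteratedDeriv_eq, iteratedDeriv_mgf (hInt hy), ← integral_const_mul]
  refine integral_nonneg_of_ae ?_
  filter_upwards [hae] with x hx
  simp only [Pi.zero_apply]
  rw [← mul_assoc, ← mul_pow]
  have : (-1 : ℝ) * -x = x := by ring
  rw [this]
  positivity

/-- Necessity computation for Theorem 2, upper half-plane: with
`a_f = ∫ sign(x) e^{-|x|} dσ(x)` and `σ₁ = 2·σ|_{[0,∞)} - σ({0})·δ₀`, one has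
`K_f(iy) + a_f = ∫_{[0,∞)} e^{-yx} dσ₁(x)` for `y > 0`; in particular
`y ↦ K_f(iy) + a_f` is completely monotonic on `(0,∞)`. -/
theorem stmt_6 (σ : Measure ℝ) [IsProbabilityMeasure σ] (f : ℝ → ℂ)
    (hf : ∀ x : ℝ, f x = ∫ t : ℝ, Complex.exp (Complex.I * x * t) ∂σ)
    (hc : Continuous f) (hb : ∃ M : ℝ, ∀ x : ℝ, ‖f x‖ ≤ M)
    (a : ℝ) (ha : a = ∫ x : ℝ, Real.sign x * Real.exp (-|x|) ∂σ)
    (σ₁ : Measure ℝ)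
    (hσ₁ : σ₁ = (2 : ℝ≥0∞) • σ.restrict (Ici 0) - σ {0} • Measure.dirac (0 : ℝ)) :
    (∀ y ∈ Ioi (0 : ℝ),
        modCauchyTransform f (Complex.I * y) + (a : ℂ) =
          ((∫ x in Ici (0 : ℝ), Real.exp (-y * x) ∂σ₁ : ℝ) : ℂ)) ∧
      ((∀ y ∈ Ioi (0 : ℝ), (modCauchyTransform f (Complex.I * y) + (a : ℂ)).im = 0) ∧
        CompletelyMonotonicOn
          (fun y : ℝ => (modCauchyTransform f (Complex.I * y) + (a : ℂ)).re) (Ioi 0)) := by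
  have hfin : IsFiniteMeasure σ₁ := by
    rw [hσ₁]
    have : IsFiniteMeasure ((2 : ℝ≥0∞) • σ.restrict (Ici 0)) := by
      rw [two_smul]; infer_instance
    exact isFiniteMeasure_of_le _ Measure.sub_le
  have H : ∀ y ∈ Ioi (0 : ℝ),
        modCauchyTransform f (Complex.I * y) + (a : ℂ) =
          ((∫ x in Ici (0 : ℝ), Real.exp (-y * x) ∂σ₁ : ℝ) : ℂ) := by
    intro y hy
    rw [modCauchy_eq σ f hf hy, ha, main_eq σ hy, hσ₁, sigma1_eq]
  refine ⟨H, ?_, ?_⟩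
  · intro y hy
    rw [H y hy, Complex.ofReal_im]
  · refine laplace_cm σ₁ _ ?_
    intro y hy
    rw [H y hy, Complex.ofReal_re]
end

section
/- Let f : ℝ → ℂ be a bounded continuous function satisfying ∫ℝ |f(t)|/(1 + |t|) dt < ∞, and let k_f be its Cauchy transform. If the function y ↦ k_f(iy) is real-valued and completely monotonic on (0, ∞), then there exists a nonnegative (not necessarily finite) measure μ supported on [0, ∞) such that for every z in the upper half-plane ℂ⁺ = {z : Im z > 0}, k_f(z) = ∫_{[0,∞)} e^{izt} dμ(t), the integral being absolutely convergent. -/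
open MeasureTheory Complex Set
open scoped ENNReal ComplexOrder

namespace CMProof
open Filter Topology

/-- Moments of the discrete Hausdorff approximants. -/
noncomputable def hS (b : ℕ → ℕ → ℝ) (n k : ℕ) : ℝ :=
  ∑ j ∈ Finset.range (n + 1), (n.choose j : ℝ) * b (n - j) j * ((j : ℝ) / n) ^ k

lemma mass_eq (b : ℕ → ℕ → ℝ) (hrec : ∀ m j, b (m + 1) j = b m j - b m (j + 1)) (n : ℕ) :
    ∑ j ∈ Finset.range (n + 1), (n.choose j : ℝ) * b (n - j) j = b 0 0 := by
  induction n with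
  | zero => simp
  | succ n ih =>
    rw [Finset.sum_choose_succ_mul (fun i l => b l i) n, ← Finset.sum_add_distrib, ← ih]
    refine Finset.sum_congr rfl fun j hj => ?_
    have hj' : j ≤ n := by simpa [Nat.lt_succ_iff] using hj
    rw [Nat.succ_sub hj', hrec]
    ring

lemma hS_tendsto (k : ℕ) : ∀ (b : ℕ → ℕ → ℝ), (∀ m j, 0 ≤ b m j) →
    (∀ m j, b (m + 1) j = b m j - b m (j + 1)) →
    Tendsto (fun n => hS b n k) atTop (𝓝 (b 0 k)) := by
  induction k with
  | zero =>
    intro b _ hrec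
    simp only [hS, pow_zero, mul_one, mass_eq b hrec]
    exact tendsto_const_nhds
  | succ k ih =>
    intro b hb hrec
    have h1 := ih (fun m j => b m (j + 1)) (fun m j => hb _ _) (fun m j => hrec _ _)
    rw [← tendsto_add_atTop_iff_nat 1]
    have key : ∀ n : ℕ, hS b (n + 1) (k + 1) =
        ∑ j ∈ Finset.range (n + 1), (n.choose j : ℝ) * b (n - j) (j + 1) *
          (((j : ℝ) + 1) / (n + 1)) ^ k := by
      intro n
      unfold hS
      rw [Finset.sum_range_succ']
      simp only [Nat.cast_zero, zero_div, ne_eq, Nat.add_eq_zero_iff, one_ne_zero, and_false,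
        not_false_eq_true, zero_pow, mul_zero, add_zero]
      refine Finset.sum_congr rfl fun j hj => ?_
      have h2 : ((n : ℝ) + 1) * (n.choose j : ℝ) = ((n + 1).choose (j + 1) : ℝ) * (j + 1) := by
        exact_mod_cast Nat.add_one_mul_choose_eq n j
      have h3 : ((n : ℝ) + 1) ≠ 0 := by positivity
      have h4 : (n.choose j : ℝ) = ((n + 1).choose (j + 1) : ℝ) * ((j + 1) / (n + 1)) := by
        field_simp
        linarith
      rw [Nat.add_sub_add_right, h4, pow_succ]
      push_cast
      ring
    have hdiff : Tendsto (fun n => hS b (n + 1) (k + 1) - hS (fun m j => b m (j + 1)) n k)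
        atTop (𝓝 0) := by
      have hlim : Tendsto (fun n : ℕ => (k : ℝ) * b 0 1 * (1 / ((n : ℝ) + 1))) atTop (𝓝 0) := by
        simpa using tendsto_one_div_add_atTop_nhds_zero_nat.const_mul ((k : ℝ) * b 0 1)
      refine squeeze_zero_norm' ?_ hlim
      filter_upwards [eventually_ge_atTop 1] with n hn
      rw [key]
      unfold hS
      rw [← Finset.sum_sub_distrib, ← mass_eq (fun m j => b m (j + 1)) (fun m j => hrec _ _) n,
        Finset.mul_sum, Finset.sum_mul]
      refine (norm_sum_le _ _).trans (Finset.sum_le_sum fun j hj => ?_)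
      have hj' : (j : ℝ) ≤ n := by
        have : j ≤ n := by simpa [Nat.lt_succ_iff] using hj
        exact_mod_cast this
      have hn' : (1 : ℝ) ≤ n := by exact_mod_cast hn
      have hj0 : (0 : ℝ) ≤ j := by positivity
      rw [← mul_sub, norm_mul, Real.norm_of_nonneg (mul_nonneg (by positivity) (hb _ _)),
        Real.norm_eq_abs]
      have hx : |((j : ℝ) + 1) / (n + 1)| ≤ 1 := by
        rw [abs_of_nonneg (by positivity), div_le_one (by positivity)]; linarith
      have hy : |(j : ℝ) / n| ≤ 1 := by
        rw [abs_of_nonneg (by positivity), div_le_one (by positivity)]; linarith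
      have hd : |((j : ℝ) + 1) / (n + 1) - j / n| ≤ 1 / (n + 1) := by
        have : ((j : ℝ) + 1) / (n + 1) - j / n = ((n - j) / n) * (1 / (n + 1)) := by
          field_simp; ring
        rw [this, abs_of_nonneg (by
          have : (0:ℝ) ≤ n - j := by linarith
          positivity)]
        refine mul_le_of_le_one_left (by positivity) ?_
        rw [div_le_one (by positivity)]; linarith
      have hp := abs_pow_sub_pow_le (((j : ℝ) + 1) / (n + 1)) (j / n) k
      have hm : max |((j : ℝ) + 1) / (n + 1)| |(j : ℝ) / n| ^ (k - 1) ≤ 1 :=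
        pow_le_one₀ (le_max_of_le_left (abs_nonneg _)) (max_le hx hy)
      have hfin : |(((j : ℝ) + 1) / (n + 1)) ^ k - (j / n : ℝ) ^ k| ≤ k * (1 / (n + 1)) := by
        refine hp.trans ?_
        calc _ ≤ (1 / ((n : ℝ) + 1)) * k * 1 := by gcongr
          _ = _ := by ring
      calc _ ≤ (n.choose j : ℝ) * b (n - j) (j + 1) * (k * (1 / (n + 1))) :=
            mul_le_mul_of_nonneg_left hfin (mul_nonneg (by positivity) (hb _ _))
        _ = _ := by ring
    have := hdiff.add h1
    simpa using this

/-- Hausdorff moment theorem. -/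
theorem hausdorff (b : ℕ → ℕ → ℝ) (hb : ∀ m j, 0 ≤ b m j)
    (hrec : ∀ m j, b (m + 1) j = b m j - b m (j + 1)) :
    ∃ ν : Measure unitInterval, IsFiniteMeasure ν ∧
      ∀ k : ℕ, ∫ x : unitInterval, (x : ℝ) ^ k ∂ν = b 0 k := by
  let νm : ℕ → Measure unitInterval := fun n =>
    ∑ j : Fin (n + 1), ENNReal.ofReal ((n.choose j : ℝ) * b (n - j) j) •
      Measure.dirac (bernstein.z j)
  have hfin : ∀ n, IsFiniteMeasure (νm n) := fun n => ⟨by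
    simp only [νm, Measure.coe_finsetSum, Finset.sum_apply, Measure.smul_apply, smul_eq_mul]
    refine ENNReal.sum_lt_top.2 fun j _ => ?_
    exact ENNReal.mul_lt_top ENNReal.ofReal_lt_top (measure_lt_top _ _)⟩
  have hw : ∀ n j, 0 ≤ (n.choose j : ℝ) * b (n - j) j :=
    fun n j => mul_nonneg (by positivity) (hb _ _)
  let ν : ℕ → FiniteMeasure unitInterval := fun n => ⟨νm n, hfin n⟩
  have hmom : ∀ n k, ∫ x : unitInterval, (x : ℝ) ^ k ∂(ν n : Measure unitInterval) = hS b n k := by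
    intro n k
    change ∫ x : unitInterval, (x : ℝ) ^ k ∂(νm n) = hS b n k
    simp only [νm]
    rw [integral_finsetSum_measure]
    · simp only [integral_smul_measure, integral_dirac, hS, Finset.sum_range]
      refine Finset.sum_congr rfl fun j _ => ?_
      rw [ENNReal.toReal_ofReal (hw _ _)]
      simp [bernstein.z]
    · intro j _
      refine Integrable.smul_measure ?_ ENNReal.ofReal_ne_top
      exact integrable_dirac (by simp)
  have hmass : ∀ n, (ν n).mass ≤ (b 0 0).toNNReal := by
    intro n
    have h := hmom n 0
    simp only [pow_zero, integral_const, smul_eq_mul, mul_one, hS, mass_eq b hrec] at h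
    rw [← NNReal.coe_le_coe, Real.coe_toNNReal _ (hb _ _), ← h]
    rfl
  obtain ⟨μ, -, hμ⟩ := (isCompact_setOfPred_finiteMeasure_le_of_compactSpace unitInterval
    (b 0 0).toNNReal).exists_mapClusterPt (f := atTop) (u := ν) (by simp [hmass])
  refine ⟨μ, inferInstance, fun k => ?_⟩
  let g : BoundedContinuousFunction unitInterval ℝ :=
    BoundedContinuousFunction.mkOfCompact ⟨fun x => (x : ℝ) ^ k, by fun_prop⟩
  have h1 : Tendsto (fun μ : FiniteMeasure unitInterval => ∫ x, g x ∂(μ : Measure unitInterval))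
      (𝓝 μ) (𝓝 (∫ x, g x ∂(μ : Measure unitInterval))) :=
    FiniteMeasure.tendsto_iff_forall_integral_tendsto.1 tendsto_id g
  have h2 := hμ.tendsto_comp h1
  have h3 : Tendsto ((fun μ : FiniteMeasure unitInterval =>
      ∫ x, g x ∂(μ : Measure unitInterval)) ∘ ν) atTop (𝓝 (b 0 k)) := by
    refine (hS_tendsto k b hb hrec).congr fun n => (hmom n k).symm
  have h4 : ClusterPt (∫ x, g x ∂(μ : Measure unitInterval)) (𝓝 (b 0 k)) := ClusterPt.mono h2 h3
  exact eq_of_nhds_neBot h4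

/-- Backward difference. -/
def bD (h : ℝ) (g : ℝ → ℝ) : ℝ → ℝ := fun y => g y - g (y + h)

lemma cm_bD {h : ℝ} (hh : 0 < h) {g : ℝ → ℝ} (hg : CompletelyMonotonicOn g (Ioi 0)) :
    CompletelyMonotonicOn (bD h g) (Ioi 0) := by
  obtain ⟨hs, hn⟩ := hg
  have hmaps : MapsTo (fun y : ℝ => y + h) (Ioi 0) (Ioi 0) := fun y hy => by
    simp only [mem_Ioi] at *; linarith
  have hs2 : ContDiffOn ℝ (⊤ : ℕ∞) (fun y => g (y + h)) (Ioi 0) :=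
    hs.comp (by fun_prop) hmaps
  refine ⟨hs.sub hs2, fun n x hx => ?_⟩
  have hat : ∀ y ∈ Ioi (0 : ℝ), ContDiffAt ℝ (⊤ : ℕ∞) g y := fun y hy =>
    hs.contDiffAt (Ioi_mem_nhds hy)
  have hat2 : ContDiffAt ℝ (⊤ : ℕ∞) (fun y => g (y + h)) x := hs2.contDiffAt (Ioi_mem_nhds hx)
  have e : iteratedDeriv n (bD h g) x = iteratedDeriv n g x - iteratedDeriv n g (x + h) := by
    unfold bD
    rw [iteratedDeriv_fun_sub ((hat x hx).of_le (by exact_mod_cast le_top))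
      (hat2.of_le (by exact_mod_cast le_top)), iteratedDeriv_comp_add_const]
  have hd : ∀ y ∈ Ioi (0 : ℝ), HasDerivAt (fun y => (-1 : ℝ) ^ n * iteratedDeriv n g y)
      ((-1 : ℝ) ^ n * iteratedDeriv (n + 1) g y) y := by
    intro y hy
    refine HasDerivAt.const_mul _ ?_
    rw [iteratedDeriv_succ]
    refine DifferentiableAt.hasDerivAt ?_
    have hF : DifferentiableAt ℝ (iteratedFDeriv ℝ n g) y :=
      ContDiffAt.differentiableAt_iteratedFDeriv (hat y hy)
        (by exact_mod_cast WithTop.coe_lt_top n)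
    exact hF.continuousMultilinear_apply_const _
  have hanti : AntitoneOn (fun y => (-1 : ℝ) ^ n * iteratedDeriv n g y) (Ioi 0) := by
    refine antitoneOn_of_deriv_nonpos (convex_Ioi 0)
      (fun y hy => (hd y hy).continuousAt.continuousWithinAt)
      (fun y hy => (hd y (interior_subset hy)).differentiableAt.differentiableWithinAt)
      (fun y hy => ?_)
    have hy' := interior_subset hy
    rw [(hd y hy').deriv]
    have := hn (n + 1) y hy'
    rw [pow_succ] at this
    linarith
  have := hanti hx (hmaps hx) (by linarith)
  rw [e, mul_sub]
  simpa using this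

lemma cm_bD_iter {h : ℝ} (hh : 0 < h) {g : ℝ → ℝ} (hg : CompletelyMonotonicOn g (Ioi 0))
    (m : ℕ) : CompletelyMonotonicOn ((bD h)^[m] g) (Ioi 0) := by
  induction m with
  | zero => exact hg
  | succ m ih => rw [Function.iterate_succ_apply']; exact cm_bD hh ih

lemma moments_unique (μ ν : Measure unitInterval) [IsFiniteMeasure μ] [IsFiniteMeasure ν]
    (h : ∀ k : ℕ, ∫ x : unitInterval, (x : ℝ) ^ k ∂μ = ∫ x : unitInterval, (x : ℝ) ^ k ∂ν) :
    μ = ν := by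
  refine ext_of_forall_integral_eq_of_IsFiniteMeasure fun f => ?_
  have hint : ∀ (ρ : Measure unitInterval) [IsFiniteMeasure ρ] (g : C(unitInterval, ℝ)),
      Integrable (fun x => g x) ρ := fun ρ _ g =>
    (BoundedContinuousFunction.mkOfCompact g).integrable ρ
  have hp : ∀ p : Polynomial ℝ, ∫ x : unitInterval, p.eval (x : ℝ) ∂μ =
      ∫ x : unitInterval, p.eval (x : ℝ) ∂ν := by
    intro p
    simp only [Polynomial.eval_eq_sum_range]
    have hi : ∀ (ρ : Measure unitInterval) [IsFiniteMeasure ρ] (i : ℕ),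
        Integrable (fun x : unitInterval => p.coeff i * (x : ℝ) ^ i) ρ := fun ρ _ i =>
      hint ρ ⟨fun x : unitInterval => p.coeff i * (x : ℝ) ^ i, by fun_prop⟩
    rw [integral_finsetSum _ (fun i _ => hi μ i), integral_finsetSum _ (fun i _ => hi ν i)]
    refine Finset.sum_congr rfl fun i _ => ?_
    rw [integral_const_mul, integral_const_mul, h]
  have hcl : ∀ (ρ : Measure unitInterval) [IsFiniteMeasure ρ],
      Continuous fun g : C(unitInterval, ℝ) => ∫ x, g x ∂ρ := by
    intro ρ _
    refine (LipschitzWith.of_dist_le_mul (K := (ρ.real univ).toNNReal) fun g g' => ?_).continuous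
    rw [Real.dist_eq, ← integral_sub (hint ρ g) (hint ρ g'),
      Real.coe_toNNReal _ measureReal_nonneg, mul_comm, ← Real.norm_eq_abs]
    refine norm_integral_le_of_norm_le_const (Eventually.of_forall fun x => ?_)
    rw [← dist_eq_norm]
    exact ContinuousMap.dist_apply_le_dist x
  have hmem : (f.toContinuousMap : C(unitInterval, ℝ)) ∈
      ((polynomialFunctions unitInterval).topologicalClosure : Subalgebra ℝ _) := by
    rw [polynomialFunctions_closure_eq_top']; trivial
  have hsub : ((polynomialFunctions unitInterval).topologicalClosure : Set C(unitInterval, ℝ)) ⊆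
      {g | ∫ x, g x ∂μ = ∫ x, g x ∂ν} := by
    rw [Subalgebra.topologicalClosure_coe]
    refine closure_minimal ?_ (isClosed_eq (hcl μ) (hcl ν))
    rintro g hg
    rw [polynomialFunctions_coe] at hg
    obtain ⟨p, rfl⟩ := hg
    simpa using hp p
  exact hsub hmem

lemma laplace_unique (σ σ' : Measure ℝ) (h0 : σ (Iio 0) = 0) (h0' : σ' (Iio 0) = 0)
    (hfin : ∀ k : ℕ, ∫⁻ t, ENNReal.ofReal (Real.exp (-((k : ℝ) + 2) * t)) ∂σ ≠ ∞)
    (h : ∀ k : ℕ, ∫⁻ t, ENNReal.ofReal (Real.exp (-((k : ℝ) + 2) * t)) ∂σ =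
      ∫⁻ t, ENNReal.ofReal (Real.exp (-((k : ℝ) + 2) * t)) ∂σ') : σ = σ' := by
  let e : ℝ → unitInterval := fun t => projIcc 0 1 zero_le_one (Real.exp (-t))
  have he : Measurable e := by
    have : Continuous e := continuous_projIcc.comp (by fun_prop)
    exact this.measurable
  have he0 : ∀ t : ℝ, 0 ≤ t → (e t : ℝ) = Real.exp (-t) := by
    intro t ht
    have : Real.exp (-t) ∈ Icc (0 : ℝ) 1 := ⟨(Real.exp_pos _).le, by simpa using ht⟩
    simp [e, projIcc_of_mem zero_le_one this]
  let w : ℝ → ℝ≥0∞ := fun t => ENNReal.ofReal (Real.exp (-2 * t))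
  have hw : Measurable w := by fun_prop
  let L : unitInterval → ℝ := fun x => -Real.log x
  have hL : Measurable L := by fun_prop
  have hae : ∀ ρ : Measure ℝ, ρ (Iio 0) = 0 → ∀ᵐ t ∂ρ, 0 ≤ t := by
    intro ρ hρ
    rw [ae_iff]
    simpa [Iio_def] using hρ
  have hmom : ∀ ρ : Measure ℝ, ρ (Iio 0) = 0 → ∀ k : ℕ,
      ∫⁻ x, ENNReal.ofReal ((x : ℝ) ^ k) ∂((ρ.withDensity w).map e) =
        ∫⁻ t, ENNReal.ofReal (Real.exp (-((k : ℝ) + 2) * t)) ∂ρ := by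
    intro ρ hρ k
    rw [lintegral_map (by fun_prop) he,
      lintegral_withDensity_eq_lintegral_mul _ hw (by fun_prop)]
    refine lintegral_congr_ae ?_
    filter_upwards [hae ρ hρ] with t ht
    simp only [Pi.mul_apply, w]
    rw [he0 t ht, ← ENNReal.ofReal_mul (Real.exp_pos _).le, ← Real.exp_nat_mul, ← Real.exp_add]
    congr 2
    ring
  have hrec : ∀ ρ : Measure ℝ, ρ (Iio 0) = 0 →
      ρ = (((ρ.withDensity w).map e).map L).withDensity
        (fun t => ENNReal.ofReal (Real.exp (2 * t))) := by
    intro ρ hρ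
    have h1 : ((ρ.withDensity w).map e).map L = ρ.withDensity w := by
      rw [Measure.map_map hL he]
      conv_rhs => rw [← Measure.map_id (μ := ρ.withDensity w)]
      refine Measure.map_congr ?_
      refine (withDensity_absolutelyContinuous ρ w) ?_
      filter_upwards [hae ρ hρ] with t ht
      simp [L, he0 t ht]
    rw [h1, ← withDensity_mul _ hw (by fun_prop)]
    conv_lhs => rw [← withDensity_one (μ := ρ)]
    congr 1
    funext t
    simp only [Pi.mul_apply, w, Pi.one_apply]
    rw [← ENNReal.ofReal_mul (Real.exp_pos _).le, ← Real.exp_add]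
    simp
  have hfm : ∀ ρ : Measure ℝ, ρ (Iio 0) = 0 →
      ∫⁻ t, ENNReal.ofReal (Real.exp (-(((0 : ℕ) : ℝ) + 2) * t)) ∂ρ ≠ ∞ →
      IsFiniteMeasure ((ρ.withDensity w).map e) := by
    intro ρ hρ hf
    refine ⟨?_⟩
    rw [← hmom ρ hρ 0] at hf
    simpa [lt_top_iff_ne_top] using hf
  have i1 := hfm σ h0 (hfin 0)
  have i2 := hfm σ' h0' (h 0 ▸ hfin 0)
  have hκ : (σ.withDensity w).map e = (σ'.withDensity w).map e := by
    refine moments_unique _ _ fun k => ?_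
    rw [integral_eq_lintegral_of_nonneg_ae (Eventually.of_forall fun x => pow_nonneg x.2.1 k)
        (by fun_prop),
      integral_eq_lintegral_of_nonneg_ae (Eventually.of_forall fun x => pow_nonneg x.2.1 k)
        (by fun_prop), hmom σ h0, hmom σ' h0', h]
  rw [hrec σ h0, hrec σ' h0', hκ]

lemma exists_grid (ω : ℝ → ℝ) (hω : CompletelyMonotonicOn ω (Ioi 0)) {h : ℝ} (hh : 0 < h) :
    ∃ σ : Measure ℝ, σ (Iio 0) = 0 ∧ ∀ k : ℕ,
      ∫⁻ t, ENNReal.ofReal (Real.exp (-(((k : ℝ) + 2) * h) * t)) ∂σ =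
        ENNReal.ofReal (ω (((k : ℝ) + 2) * h)) := by
  obtain ⟨ν, hν, hmom⟩ := hausdorff (fun m j => (bD h)^[m] ω (((j : ℝ) + 1) * h))
    (fun m j => by
      simpa using (cm_bD_iter hh hω m).2 0 (((j : ℝ) + 1) * h) (by
        simp only [mem_Ioi]; positivity))
    (fun m j => by
      rw [Function.iterate_succ_apply']
      simp only [bD]
      congr 2
      push_cast
      ring)
  let u : unitInterval → ℝ := fun x => -Real.log x / h
  have hu : Measurable u := by fun_prop
  refine ⟨((ν.restrict {x | (x : ℝ) ≠ 0}).map u).withDensity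
    (fun t => ENNReal.ofReal (Real.exp (h * t))), ?_, fun k => ?_⟩
  · refine withDensity_absolutelyContinuous _ _ ?_
    rw [Measure.map_apply hu measurableSet_Iio]
    have : u ⁻¹' Iio 0 = ∅ := by
      ext x
      simp only [mem_preimage, mem_Iio, mem_empty_iff_false, iff_false, not_lt, u]
      have := Real.log_nonpos x.2.1 x.2.2
      exact div_nonneg (by linarith) hh.le
    simp [this]
  · have hS : MeasurableSet {x : unitInterval | (x : ℝ) ≠ 0} :=
      (measurable_subtype_coe (measurableSet_singleton (0 : ℝ))).compl
    rw [lintegral_withDensity_eq_lintegral_mul _ (by fun_prop) (by fun_prop),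
      lintegral_map (by fun_prop) hu, ← lintegral_indicator hS]
    have hm := hmom (k + 1)
    rw [integral_eq_lintegral_of_nonneg_ae (Eventually.of_forall fun x => pow_nonneg x.2.1 _)
        (by fun_prop)] at hm
    have e1 : (((k + 1 : ℕ) : ℝ) + 1) * h = ((k : ℝ) + 2) * h := by push_cast; ring
    simp only [Function.iterate_zero, id, e1] at hm
    rw [← hm, ENNReal.ofReal_toReal]
    · refine lintegral_congr fun x => ?_
      by_cases hx : (x : ℝ) = 0
      · rw [indicator_of_notMem (by simpa using hx)]
        simp [hx]
      · have hx0 : (0 : ℝ) < x := lt_of_le_of_ne x.2.1 (Ne.symm hx)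
        rw [indicator_of_mem (show x ∈ {x : unitInterval | (x : ℝ) ≠ 0} from hx)]
        simp only [Pi.mul_apply, u]
        rw [← ENNReal.ofReal_mul (Real.exp_pos _).le, ← Real.exp_add]
        congr 1
        have e2 : (x : ℝ) ^ (k + 1) = Real.exp (((k + 1 : ℕ) : ℝ) * Real.log x) := by
          rw [Real.exp_nat_mul, Real.exp_log hx0]
        rw [e2, Real.exp_eq_exp]
        push_cast
        field_simp
        ring
    · refine ne_of_lt (lt_of_le_of_lt (lintegral_mono (g := fun _ => 1) fun x => ?_) ?_)
      · rw [ENNReal.ofReal_le_one]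
        exact pow_le_one₀ x.2.1 x.2.2
      · simp

lemma bernstein_cm (ω : ℝ → ℝ) (hω : CompletelyMonotonicOn ω (Ioi 0)) :
    ∃ σ : Measure ℝ, σ (Iio 0) = 0 ∧ ∀ k n : ℕ,
      ∫⁻ t, ENNReal.ofReal (Real.exp (-(((k : ℝ) + 2) * (1 / ((n : ℝ) + 1))) * t)) ∂σ =
        ENNReal.ofReal (ω (((k : ℝ) + 2) * (1 / ((n : ℝ) + 1)))) := by
  obtain ⟨σ, h0, hσ⟩ := exists_grid ω hω one_pos
  refine ⟨σ, h0, fun k n => ?_⟩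
  obtain ⟨σ', h0', hσ'⟩ := exists_grid ω hω (h := 1 / ((n : ℝ) + 1)) (by positivity)
  have : σ = σ' := by
    refine laplace_unique σ σ' h0 h0' (fun k => ?_) (fun k => ?_)
    · have := hσ k
      rw [mul_one] at this
      rw [this]
      exact ENNReal.ofReal_ne_top
    · have h1 := hσ k
      have h2 := hσ' ((k + 2) * n + k)
      have e : ((((k + 2) * n + k : ℕ) : ℝ) + 2) * (1 / ((n : ℝ) + 1)) = (k : ℝ) + 2 := by
        push_cast
        field_simp
        ring
      rw [e] at h2
      rw [mul_one] at h1
      rw [h1, h2]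
  rw [this]
  exact hσ' k

lemma cauchy_differentiable (f : ℝ → ℂ) (hc : Continuous f)
    (hint : Integrable (fun t : ℝ => ‖f t‖ / (1 + |t|))) :
    DifferentiableOn ℂ (cauchyTransform f) {z : ℂ | 0 < z.im} := by
  intro z₀ hz₀
  simp only [mem_setOf_eq] at hz₀
  refine DifferentiableAt.differentiableWithinAt ?_
  unfold cauchyTransform
  refine DifferentiableAt.const_mul ?_ _
  set ε := z₀.im / 2 with hε
  have hε0 : 0 < ε := by positivity
  set R := ‖z₀‖ + ε with hR
  have hR0 : 0 ≤ R := by positivity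
  set C := (1 + R) / ε + 1 with hC
  have hC0 : 0 < C := by positivity
  have him : ∀ z ∈ Metric.ball z₀ ε, ∀ t : ℝ, ε ≤ ‖z - t‖ := by
    intro z hz t
    have h1 : |(z - z₀).im| ≤ ‖z - z₀‖ := Complex.abs_im_le_norm _
    rw [Metric.mem_ball, dist_eq_norm] at hz
    have h2 := (abs_le.1 (h1.trans hz.le)).1
    have h3 : |(z - t).im| ≤ ‖z - t‖ := Complex.abs_im_le_norm _
    simp only [Complex.sub_im, Complex.ofReal_im, sub_zero] at h2 h3
    have := le_abs_self z.im
    linarith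
  have hlow : ∀ z ∈ Metric.ball z₀ ε, ∀ t : ℝ, 1 + |t| ≤ C * ‖z - t‖ := by
    intro z hz t
    have h1 := him z hz t
    rw [Metric.mem_ball, dist_eq_norm] at hz
    have h2 : ‖z‖ ≤ R := by
      have := norm_add_le z₀ (z - z₀)
      rw [add_sub_cancel] at this
      linarith
    have h3 : |t| ≤ ‖z‖ + ‖z - t‖ := by
      have := norm_sub_le z (z - t)
      rw [sub_sub_cancel, Complex.norm_real, Real.norm_eq_abs] at this
      exact this
    have h4 : 1 + R ≤ (1 + R) / ε * ‖z - t‖ := by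
      rw [div_mul_eq_mul_div, le_div_iff₀ hε0]
      gcongr
    have : C * ‖z - t‖ = (1 + R) / ε * ‖z - t‖ + ‖z - t‖ := by rw [hC]; ring
    linarith
  have hmeas : ∀ z : ℂ, AEStronglyMeasurable (fun t : ℝ => f t / (z - t)) := by
    intro z
    have : Measurable (fun t : ℝ => f t / (z - t)) := by
      have := hc.measurable
      fun_prop
    exact this.aestronglyMeasurable
  have hpos : ∀ z ∈ Metric.ball z₀ ε, ∀ t : ℝ, 0 < ‖z - t‖ := fun z hz t =>
    hε0.trans_le (him z hz t)
  have key := hasDerivAt_integral_of_dominated_loc_of_deriv_le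
    (F := fun (z : ℂ) (t : ℝ) => f t / (z - t)) (F' := fun z t => -f t / (z - t) ^ 2)
    (x₀ := z₀) (s := Metric.ball z₀ ε) (μ := volume)
    (bound := fun t => C / ε * (‖f t‖ / (1 + |t|)))
    (Metric.ball_mem_nhds z₀ hε0) (Eventually.of_forall hmeas) ?_ ?_ ?_ (hint.const_mul _) ?_
  · exact key.2.differentiableAt
  · refine (hint.const_mul C).mono' (hmeas z₀) (Eventually.of_forall fun t => ?_)
    have hb := Metric.mem_ball_self (x := z₀) hε0
    rw [norm_div, div_le_iff₀ (hpos _ hb t)]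
    have := hlow z₀ hb t
    have ht : (0 : ℝ) < 1 + |t| := by positivity
    calc ‖f t‖ = ‖f t‖ / (1 + |t|) * (1 + |t|) := by field_simp
      _ ≤ ‖f t‖ / (1 + |t|) * (C * ‖z₀ - t‖) := by gcongr
      _ = _ := by ring
  · have : Measurable (fun t : ℝ => -f t / (z₀ - t) ^ 2) := by
      have := hc.measurable
      fun_prop
    exact this.aestronglyMeasurable
  · refine Eventually.of_forall fun t z hz => ?_
    have hp := hpos z hz t
    rw [norm_div, norm_neg, norm_pow, div_le_iff₀ (by positivity)]
    have h1 := hlow z hz t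
    have h2 := him z hz t
    have ht : (0 : ℝ) < 1 + |t| := by positivity
    have h3 : 1 + |t| ≤ C / ε * ‖z - t‖ ^ 2 := by
      refine h1.trans ?_
      rw [div_mul_eq_mul_div, le_div_iff₀ hε0, pow_two, mul_assoc]
      gcongr
    calc ‖f t‖ = ‖f t‖ / (1 + |t|) * (1 + |t|) := by field_simp
      _ ≤ ‖f t‖ / (1 + |t|) * (C / ε * ‖z - t‖ ^ 2) := by gcongr
      _ = _ := by ring
  · refine Eventually.of_forall fun t z hz => ?_
    have hne : z - t ≠ 0 := norm_pos_iff.1 (hpos z hz t)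
    have := ((hasDerivAt_id z).sub_const (t : ℂ)).inv hne |>.const_mul (f t)
    convert! this using 1
    simp only [id]
    ring

end CMProof

/-- If `y ↦ k_f(iy)` is real-valued and completely monotonic on `(0,∞)`, then there is a
nonnegative measure `μ` supported on `[0,∞)` with `k_f(z) = ∫_{[0,∞)} e^{izt} dμ(t)`
(absolutely convergent) for every `z` in the upper half-plane. -/
theorem stmt_14 (f : ℝ → ℂ) (hc : Continuous f) (hb : ∃ M : ℝ, ∀ x : ℝ, ‖f x‖ ≤ M)
    (hint : Integrable (fun t : ℝ => ‖f t‖ / (1 + |t|)))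
    (hre : ∀ y ∈ Ioi (0 : ℝ), (cauchyTransform f (Complex.I * y)).im = 0)
    (hcm : CompletelyMonotonicOn (fun y : ℝ => (cauchyTransform f (Complex.I * y)).re) (Ioi 0)) :
    ∃ μ : Measure ℝ, μ (Iio 0) = 0 ∧
      ∀ z : ℂ, 0 < z.im →
        Integrable (fun t : ℝ => Complex.exp (Complex.I * z * t)) μ ∧
          cauchyTransform f z = ∫ t in Ici (0 : ℝ), Complex.exp (Complex.I * z * t) ∂μ := by
  classical
  obtain ⟨σ, h0, hσ⟩ := CMProof.bernstein_cm _ hcm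
  have hae : ∀ᵐ t ∂σ, 0 ≤ t := by
    rw [ae_iff]
    simpa [Iio_def] using h0
  have hae2 : σ.restrict (Ici 0) = σ := Measure.restrict_eq_self_of_ae_mem hae
  -- integrability of real exponentials
  have hexp0 : ∀ k n : ℕ, Integrable
      (fun t : ℝ => Real.exp (-(((k : ℝ) + 2) * (1 / ((n : ℝ) + 1))) * t)) σ := by
    intro k n
    refine ⟨by fun_prop, ?_⟩
    rw [hasFiniteIntegral_iff_ofReal (Filter.Eventually.of_forall fun t => (Real.exp_pos _).le),
      hσ k n]
    exact ENNReal.ofReal_lt_top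
  have hexp : ∀ s : ℝ, 0 < s → Integrable (fun t : ℝ => Real.exp (-s * t)) σ := by
    intro s hs
    obtain ⟨n, hn⟩ := exists_nat_one_div_lt (half_pos hs)
    refine (hexp0 0 n).mono' (by fun_prop) ?_
    filter_upwards [hae] with t ht
    rw [Real.norm_of_nonneg (Real.exp_pos _).le, Real.exp_le_exp]
    refine mul_le_mul_of_nonneg_right ?_ ht
    push_cast
    linarith
  have hint' : ∀ z : ℂ, 0 < z.im →
      Integrable (fun t : ℝ => Complex.exp (Complex.I * z * t)) σ := by
    intro z hz
    refine (hexp z.im hz).mono' (by fun_prop) (Filter.Eventually.of_forall fun t => ?_)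
    rw [Complex.norm_exp]
    simp
  refine ⟨σ, h0, fun z hz => ⟨hint' z hz, ?_⟩⟩
  rw [hae2]
  let G : ℂ → ℂ := fun z => ∫ t : ℝ, Complex.exp (Complex.I * z * t) ∂σ
  have hU : IsOpen {z : ℂ | 0 < z.im} := isOpen_lt continuous_const Complex.continuous_im
  have hset : Iio (0 : ℝ) ⊆ interior (ProbabilityTheory.integrableExpSet id σ) := by
    refine interior_maximal (fun s hs => ?_) isOpen_Iio
    have := hexp (-s) (by simpa using hs)
    simpa [ProbabilityTheory.integrableExpSet] using this
  have hG : DifferentiableOn ℂ G {z : ℂ | 0 < z.im} := by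
    intro z hz
    have hre' : (Complex.I * z).re ∈ interior (ProbabilityTheory.integrableExpSet id σ) := by
      apply hset
      simpa using hz
    have h1 := (ProbabilityTheory.hasDerivAt_complexMGF hre').differentiableAt
    have h2 : DifferentiableAt ℂ (fun z : ℂ => Complex.I * z) z := by fun_prop
    exact (h1.comp z h2).differentiableWithinAt
  have hconn : IsPreconnected {z : ℂ | 0 < z.im} :=
    (convex_halfSpace_im_gt 0).isPreconnected
  have hfreq : ∃ᶠ w in nhdsWithin Complex.I {Complex.I}ᶜ, cauchyTransform f w = G w := by
    have ht : Filter.Tendsto (fun n : ℕ => Complex.I * ((1 + 1 / ((n : ℝ) + 1) : ℝ) : ℂ))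
        Filter.atTop (nhdsWithin Complex.I {Complex.I}ᶜ) := by
      refine tendsto_nhdsWithin_iff.2 ⟨?_, Filter.Eventually.of_forall fun n => ?_⟩
      · have h1 : Filter.Tendsto (fun n : ℕ => (1 + 1 / ((n : ℝ) + 1) : ℝ)) Filter.atTop
            (nhds 1) := by
          simpa using tendsto_one_div_add_atTop_nhds_zero_nat.const_add (1 : ℝ)
        have h2 := ((Complex.continuous_ofReal.tendsto (1 : ℝ)).comp h1).const_mul Complex.I
        simpa using h2
      · simp only [mem_compl_iff, mem_singleton_iff]
        intro h
        have h3 := congrArg Complex.im h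
        have h4 : (0 : ℝ) < 1 / ((n : ℝ) + 1) := by positivity
        rw [Complex.I_mul_im, Complex.ofReal_re, Complex.I_im] at h3
        linarith
    refine ht.frequently (Filter.Eventually.frequently (Filter.Eventually.of_forall fun n => ?_))
    have e : (1 + 1 / ((n : ℝ) + 1) : ℝ) = ((n : ℝ) + 2) * (1 / ((n : ℝ) + 1)) := by
      field_simp
      ring
    set s : ℝ := 1 + 1 / ((n : ℝ) + 1) with hs
    have hs0 : 0 < s := by positivity
    have h1 := hσ n n
    rw [← e] at h1
    have hnn : 0 ≤ (cauchyTransform f (Complex.I * s)).re := by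
      simpa using hcm.2 0 s hs0
    have h2 : ∫ t : ℝ, Real.exp (-s * t) ∂σ = (cauchyTransform f (Complex.I * s)).re := by
      rw [integral_eq_lintegral_of_nonneg_ae
        (Filter.Eventually.of_forall fun t => (Real.exp_pos _).le) (by fun_prop), h1,
        ENNReal.toReal_ofReal hnn]
    have h3 : G (Complex.I * s) = ((∫ t : ℝ, Real.exp (-s * t) ∂σ : ℝ) : ℂ) := by
      rw [← integral_complex_ofReal]
      refine integral_congr_ae (Filter.Eventually.of_forall fun t => ?_)
      simp only [Complex.ofReal_exp]
      congr 1
      push_cast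
      rw [← mul_assoc, Complex.I_mul_I]
      ring
    rw [h3, h2]
    apply Complex.ext
    · simp
    · simpa using hre s hs0
  have hmain := AnalyticOnNhd.eqOn_of_preconnected_of_frequently_eq
    ((CMProof.cauchy_differentiable f hc hint).analyticOnNhd hU) (hG.analyticOnNhd hU) hconn
    (show Complex.I ∈ {z : ℂ | 0 < z.im} by simp) hfreq
  exact hmain hz
end

section
/- Let f : ℝ → ℂ be a bounded continuous function satisfying ∫ℝ |f(t)|/(1 + |t|) dt < ∞, and let k_f be its Cauchy transform. If the function y ↦ −k_f(iy) is real-valued and absolutely monotonic on (−∞, 0), then there exists a nonnegative measure η supported on (−∞, 0] such that for every z in the lower half-plane ℂ⁻ = {z : Im z < 0}, k_f(z) = −∫_{(−∞,0]} e^{izt} dη(t), the integral being absolutely convergent. -/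
open MeasureTheory Complex Set
open scoped ENNReal ComplexOrder

open Filter Topology in
lemma aux_measure_limit (ν : ℕ → Measure ℝ) (h0 : ∀ n, ν n (Iio 0) = 0) (G : ℕ → ℝ → ℝ) (g : ℝ → ℝ)
    (hG : ∀ n, ∀ b < 1, ∫⁻ s, ENNReal.ofReal (Real.exp (b * s)) ∂(ν n) = ENNReal.ofReal (G n b))
    (hlim : ∀ b < 1, Tendsto (fun n => G n b) atTop (𝓝 (g b))) :
    ∃ μ : Measure ℝ, IsFiniteMeasure μ ∧ μ (Iio 0) = 0 ∧
      (∀ b < 1, Integrable (fun s => Real.exp (b * s)) μ) ∧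
      ∀ b ≤ 0, ∫⁻ s, ENNReal.ofReal (Real.exp (b * s)) ∂μ = ENNReal.ofReal (g b) := by
  have hbd : ∀ b < 1, ∃ C : NNReal, ∀ n, ∫⁻ s, ENNReal.ofReal (Real.exp (b * s)) ∂(ν n) ≤ C := by
    intro b hb
    obtain ⟨C, hC⟩ := (hlim b hb).bddAbove_range
    refine ⟨C.toNNReal, fun n => ?_⟩
    rw [hG n b hb]
    exact ENNReal.ofReal_le_ofReal (hC ⟨n, rfl⟩)
  obtain ⟨C0, hC0⟩ := hbd 0 (by norm_num)
  obtain ⟨C1, hC1⟩ := hbd (1/2) (by norm_num)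
  have hmass : ∀ n, ν n univ ≤ C0 := fun n => by simpa using hC0 n
  have hfin : ∀ n, IsFiniteMeasure (ν n) := fun n => ⟨(hmass n).trans_lt ENNReal.coe_lt_top⟩
  let u : ℕ → NNReal := fun m => C1 * (Real.exp (-(1/2) * m)).toNNReal
  have hu : Tendsto u atTop (𝓝 0) := by
    have h1 : Tendsto (fun m : ℕ => Real.exp (-(1/2) * m)) atTop (𝓝 0) := by
      apply Real.tendsto_exp_atBot.comp
      exact tendsto_natCast_atTop_atTop.const_mul_atTop_of_neg (by norm_num)
    have h2 := (tendsto_real_toNNReal h1).const_mul C1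
    simpa [u] using h2
  have htail : ∀ (n m : ℕ), ν n (Icc (0:ℝ) m)ᶜ ≤ u m := by
    intro n m
    have hsub : (Icc (0:ℝ) (m:ℝ))ᶜ ⊆ Iio 0 ∪ Ioi (m:ℝ) := by
      intro x hx
      simp only [mem_compl_iff, mem_Icc, not_and_or, not_le] at hx
      exact hx
    have h1 : ν n (Icc (0:ℝ) m)ᶜ ≤ ν n (Ioi (m:ℝ)) := by
      refine (measure_mono hsub).trans ((measure_union_le _ _).trans ?_)
      rw [h0, zero_add]
    refine h1.trans ?_
    have h2 : ν n (Ioi (m:ℝ)) ≤ ∫⁻ s, ENNReal.ofReal (Real.exp (-(1/2) * m)) *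
        ENNReal.ofReal (Real.exp ((1/2) * s)) ∂(ν n) := by
      rw [← lintegral_indicator_one measurableSet_Ioi]
      apply lintegral_mono
      intro s
      by_cases hs : s ∈ Ioi (m:ℝ)
      · simp only [indicator_of_mem hs, Pi.one_apply]
        rw [← ENNReal.ofReal_mul (Real.exp_nonneg _), ← Real.exp_add, ← ENNReal.ofReal_one]
        apply ENNReal.ofReal_le_ofReal
        apply Real.one_le_exp
        have : (m:ℝ) < s := hs
        linarith
      · simp [indicator_of_notMem hs]
    refine h2.trans ?_
    rw [lintegral_const_mul _ (by fun_prop)]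
    rw [show ((u m : NNReal) : ℝ≥0∞) = ENNReal.ofReal (Real.exp (-(1/2) * m)) * C1 by
      simp only [u, ENNReal.coe_mul, mul_comm]; rfl]
    gcongr
    exact hC1 n
  have hcomp := isCompact_setOfPred_finiteMeasure_mass_le_compl_isCompact_le (E := ℝ) (u := u)
    (K := fun m : ℕ => Icc (0:ℝ) m) C0 hu (fun m => isCompact_Icc) (Or.inl inferInstance)
  let N : ℕ → FiniteMeasure ℝ := fun n => ⟨ν n, hfin n⟩
  have hNmem : ∀ n, N n ∈ {μ : FiniteMeasure ℝ | μ.mass ≤ C0 ∧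
      ∀ m : ℕ, μ (Icc (0:ℝ) m)ᶜ ≤ u m} := by
    intro n
    refine ⟨?_, fun m => ?_⟩
    · rw [← ENNReal.coe_le_coe, FiniteMeasure.ennreal_mass]
      exact hmass n
    · rw [← ENNReal.coe_le_coe, FiniteMeasure.ennreal_coeFn_eq_coeFn_toMeasure]
      exact htail n m
  let U : Ultrafilter ℕ := hyperfilter ℕ
  have hU : (U : Filter ℕ) ≤ atTop := Nat.hyperfilter_le_atTop
  obtain ⟨μ, hμmem, hμ⟩ := hcomp.ultrafilter_le_nhds (U.map N) (by
    rw [le_principal_iff, Ultrafilter.coe_map, mem_map]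
    exact Filter.mem_of_superset univ_mem (fun n _ => hNmem n))
  have hT : Tendsto N U (𝓝 μ) := hμ
  rw [FiniteMeasure.tendsto_iff_forall_lintegral_tendsto] at hT
  have hμ0 : (μ : Measure ℝ) (Iio 0) = 0 := by
    have h1 : ∀ m : ℕ, (μ : Measure ℝ) (Iio 0) ≤ u m := by
      intro m
      have h2 : (μ : Measure ℝ) (Icc (0:ℝ) m)ᶜ ≤ u m := by
        have := hμmem.2 m
        rwa [← ENNReal.coe_le_coe, FiniteMeasure.ennreal_coeFn_eq_coeFn_toMeasure] at this
      refine (measure_mono ?_).trans h2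
      intro x hx
      simp only [mem_compl_iff, mem_Icc, not_and_or, not_le]
      exact Or.inl hx
    have h3 : Tendsto (fun m => (u m : ℝ≥0∞)) atTop (𝓝 0) := by
      have := ENNReal.tendsto_coe.2 hu
      rwa [ENNReal.coe_zero] at this
    exact le_antisymm (ge_of_tendsto' h3 h1) bot_le
  -- truncated exponentials
  let φ : ℝ → NNReal → BoundedContinuousFunction ℝ NNReal := fun b K =>
    BoundedContinuousFunction.mkOfBound
      ⟨fun s => min (Real.exp (b * s)).toNNReal K, by fun_prop⟩ K (by
        intro x y
        rw [NNReal.dist_eq, abs_le]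
        simp only [ContinuousMap.coe_mk, NNReal.coe_min]
        have h1 : min ((Real.exp (b * x)).toNNReal : ℝ) K ≤ K := min_le_right _ _
        have h2 : min ((Real.exp (b * y)).toNNReal : ℝ) K ≤ K := min_le_right _ _
        have h3 : 0 ≤ min ((Real.exp (b * x)).toNNReal : ℝ) K := by positivity
        have h4 : 0 ≤ min ((Real.exp (b * y)).toNNReal : ℝ) K := by positivity
        constructor <;> linarith)
  have hφ : ∀ b K s, ((φ b K s : NNReal) : ℝ≥0∞) = min (ENNReal.ofReal (Real.exp (b * s))) K := by
    intro b K s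
    exact ENNReal.coe_min _ _
  refine ⟨μ, inferInstance, hμ0, ?_, ?_⟩
  · intro b hb
    obtain ⟨C, hC⟩ := hbd b hb
    have h1 : ∀ K : NNReal, ∫⁻ s, (φ b K s : ℝ≥0∞) ∂(μ : Measure ℝ) ≤ C := by
      intro K
      refine le_of_tendsto' (hT (φ b K)) fun n => ?_
      refine le_trans (lintegral_mono fun s => ?_) (hC n)
      rw [hφ]
      exact min_le_left _ _
    have h2 : ∫⁻ s, ENNReal.ofReal (Real.exp (b * s)) ∂(μ : Measure ℝ) ≤ C := by
      have h3 : ∀ s, Tendsto (fun K : ℕ => ((φ b K s : NNReal) : ℝ≥0∞)) atTop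
          (𝓝 (ENNReal.ofReal (Real.exp (b * s)))) := by
        intro s
        apply tendsto_const_nhds.congr'
        obtain ⟨K0, hK0⟩ := exists_nat_ge (Real.exp (b * s))
        filter_upwards [eventually_ge_atTop K0] with K hK
        rw [hφ, min_eq_left]
        have : Real.exp (b * s) ≤ (K : ℝ) := hK0.trans (by exact_mod_cast hK)
        have := ENNReal.ofReal_le_ofReal this
        simpa using this
      calc ∫⁻ s, ENNReal.ofReal (Real.exp (b * s)) ∂(μ : Measure ℝ)
          = ∫⁻ s, liminf (fun K : ℕ => ((φ b K s : NNReal) : ℝ≥0∞)) atTop ∂(μ : Measure ℝ) := by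
            congr 1; ext s; rw [(h3 s).liminf_eq]
        _ ≤ liminf (fun K : ℕ => ∫⁻ s, ((φ b K s : NNReal) : ℝ≥0∞) ∂(μ : Measure ℝ)) atTop := by
            apply lintegral_liminf_le
            intro K
            exact (φ b K).continuous.measurable.coe_nnreal_ennreal
        _ ≤ liminf (fun K : ℕ => (C : ℝ≥0∞)) atTop :=
            liminf_le_liminf (Eventually.of_forall fun K => h1 K)
        _ = C := liminf_const _
    refine ⟨by fun_prop, ?_⟩
    rw [hasFiniteIntegral_iff_ofReal (Eventually.of_forall fun s => Real.exp_nonneg _)]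
    exact h2.trans_lt ENNReal.coe_lt_top
  · intro b hb
    have key : ∀ ρ : Measure ℝ, ρ (Iio 0) = 0 →
        ∫⁻ s, (φ b 1 s : ℝ≥0∞) ∂ρ = ∫⁻ s, ENNReal.ofReal (Real.exp (b * s)) ∂ρ := by
      intro ρ hρ
      apply lintegral_congr_ae
      have : ∀ᵐ s ∂ρ, s ∉ Iio (0:ℝ) := measure_eq_zero_iff_ae_notMem.1 hρ
      filter_upwards [this] with s hs
      have hs : 0 ≤ s := by simpa using hs
      rw [hφ, min_eq_left]
      have : Real.exp (b * s) ≤ 1 := Real.exp_le_one_iff.2 (mul_nonpos_of_nonpos_of_nonneg hb hs)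
      simpa using ENNReal.ofReal_le_ofReal this
    have h1 := hT (φ b 1)
    rw [key _ hμ0] at h1
    have h2 : Tendsto (fun n => ∫⁻ s, (φ b 1 s : ℝ≥0∞) ∂(N n : Measure ℝ)) U
        (𝓝 (ENNReal.ofReal (g b))) := by
      have h3 := (ENNReal.tendsto_ofReal (hlim b (by linarith))).mono_left hU
      refine h3.congr fun n => ?_
      rw [← hG n b (by linarith)]
      exact (key _ (h0 n)).symm
    exact tendsto_nhds_unique h1 h2

lemma aux_ne (z : ℂ) (hz : z.im < 0) (t : ℝ) : z - (t : ℂ) ≠ 0 := by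
  intro h
  have := congrArg Complex.im h
  simp at this
  linarith

lemma aux_cauchy_diff (f : ℝ → ℂ) (hc : Continuous f)
    (hint : Integrable (fun t : ℝ => ‖f t‖ / (1 + |t|))) :
    DifferentiableOn ℂ (cauchyTransform f) {z | z.im < 0} := by
  intro z0 hz0
  apply DifferentiableAt.differentiableWithinAt
  have hz0 : z0.im < 0 := hz0
  set δ : ℝ := -z0.im / 2 with hδ
  have hδ0 : 0 < δ := by linarith
  set A : ℝ := 1 + (1 + ‖z0‖ + δ) / δ with hA
  have hA0 : 0 < A := by positivity
  have him : ∀ z ∈ Metric.ball z0 δ, z.im < 0 ∧ ∀ t : ℝ, δ ≤ ‖z - t‖ := by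
    intro z hz
    have h1 : |(z - z0).im| < δ := (Complex.abs_im_le_norm _).trans_lt (by simpa [dist_eq_norm] using hz)
    rw [Complex.sub_im, abs_lt] at h1
    refine ⟨by linarith, fun t => ?_⟩
    have h2 := Complex.abs_im_le_norm (z - t)
    simp only [Complex.sub_im, Complex.ofReal_im, sub_zero] at h2
    have h3 := neg_le_abs z.im
    linarith
  have hlow : ∀ z ∈ Metric.ball z0 δ, ∀ t : ℝ, 1 + |t| ≤ A * ‖z - t‖ := by
    intro z hz t
    have h1 := (him z hz).2 t
    have h2 : ‖z‖ ≤ ‖z0‖ + δ := by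
      have : ‖z - z0‖ < δ := by simpa [dist_eq_norm] using hz
      have h3 := norm_add_le (z - z0) z0
      simp only [sub_add_cancel] at h3
      linarith
    have h3 : |t| ≤ ‖z - t‖ + ‖z‖ := by
      have h4 := norm_sub_le z (z - t)
      simp only [sub_sub_cancel, Complex.norm_real, Real.norm_eq_abs] at h4
      linarith
    have h5 : (1 + ‖z0‖ + δ) ≤ (1 + ‖z0‖ + δ) / δ * ‖z - t‖ := by
      rw [div_mul_eq_mul_div, le_div_iff₀ hδ0]
      gcongr
    rw [hA, add_mul]
    linarith
  have hb1 : ∀ z ∈ Metric.ball z0 δ, ∀ t : ℝ, ‖f t / (z - t)‖ ≤ A * (‖f t‖ / (1 + |t|)) := by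
    intro z hz t
    have h1 := (him z hz).2 t
    have h2 := hlow z hz t
    rw [norm_div, ← mul_div_assoc, div_le_div_iff₀ (by linarith) (by positivity)]
    have := norm_nonneg (f t)
    nlinarith
  have hmeas : ∀ z : ℂ, AEStronglyMeasurable (fun t : ℝ => f t / (z - t)) volume := by
    intro z
    have := hc.measurable
    exact Measurable.aestronglyMeasurable (by fun_prop)
  have hmeas' : ∀ z : ℂ, AEStronglyMeasurable (fun t : ℝ => -(f t) / (z - t)^2) volume := by
    intro z
    have := hc.measurable
    exact Measurable.aestronglyMeasurable (by fun_prop)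
  have key := hasDerivAt_integral_of_dominated_loc_of_deriv_le (μ := volume) (𝕜 := ℂ)
    (F := fun (z : ℂ) (t : ℝ) => f t / (z - t)) (F' := fun (z : ℂ) (t : ℝ) => -(f t) / (z - t)^2)
    (x₀ := z0) (s := Metric.ball z0 δ) (bound := fun t => (1/δ) * (A * (‖f t‖ / (1 + |t|))))
    (Metric.ball_mem_nhds z0 hδ0) (Filter.Eventually.of_forall hmeas)
    ((hint.const_mul A).mono' (hmeas z0)
      (Filter.Eventually.of_forall (hb1 z0 (Metric.mem_ball_self hδ0))))
    (hmeas' z0)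
    (Filter.Eventually.of_forall (by
      intro t z hz
      have h1 := (him z hz).2 t
      have h2 := hb1 z hz t
      have h3 : ‖-(f t) / (z - t)^2‖ = (1 / ‖z - t‖) * ‖f t / (z - t)‖ := by
        rw [norm_div, norm_div, norm_neg, norm_pow]
        have : 0 < ‖z - t‖ := by linarith
        field_simp
      rw [h3]
      gcongr))
    ((hint.const_mul A).const_mul (1/δ))
    (Filter.Eventually.of_forall (by
      intro t z hz
      have h0 := aux_ne z (him z hz).1 t
      have h1 : HasDerivAt (fun z : ℂ => z - (t:ℂ)) 1 z := (hasDerivAt_id z).sub_const _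
      have h2 := (hasDerivAt_const z (f t)).div h1 h0
      refine HasDerivAt.congr_deriv h2 ?_
      rw [zero_mul, zero_sub, mul_one]))
  exact (key.2.const_mul _).differentiableAt

lemma aux_deriv (F : ℂ → ℂ) (hF : DifferentiableOn ℂ F {w | w.re < 0}) (ω : ℝ → ℝ)
    (hω : ∀ y : ℝ, y < 0 → F y = ω y) (n : ℕ) :
    ∀ y : ℝ, y < 0 → iteratedDeriv n F y = (iteratedDeriv n ω y : ℝ) := by
  have hopen : IsOpen {w : ℂ | w.re < 0} := isOpen_lt Complex.continuous_re continuous_const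
  induction n with
  | zero => simpa using hω
  | succ n ih =>
    intro y hy
    have hA : AnalyticAt ℂ F y := hF.analyticAt (hopen.mem_nhds (by simpa using hy))
    have hd : HasDerivAt (iteratedDeriv n F) (iteratedDeriv (n+1) F y) y := by
      rw [iteratedDeriv_succ]
      apply DifferentiableAt.hasDerivAt
      rw [iteratedDeriv_eq_iterate]
      exact (hA.iterated_deriv n).differentiableAt
    have h1 := hd.comp_ofReal
    have h2 : HasDerivAt (fun x : ℝ => ((iteratedDeriv n ω x : ℝ) : ℂ)) (iteratedDeriv (n+1) F y) y := by
      refine h1.congr_of_eventuallyEq ?_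
      filter_upwards [Iio_mem_nhds hy] with x hx
      exact (ih x hx).symm
    have hre : HasDerivAt (iteratedDeriv n ω) (iteratedDeriv (n+1) F y).re y := by
      have := (Complex.reCLM.hasFDerivAt.comp_hasDerivAt y h2)
      simpa [Function.comp_def] using this
    have h3 := hre.ofReal_comp
    rw [iteratedDeriv_succ (f := ω), hre.deriv]
    exact h2.unique h3

open Filter Topology in
lemma aux_bernstein (F : ℂ → ℂ) (hF : DifferentiableOn ℂ F {w | w.re < 0})
    (D : ℕ → ℝ → ℝ) (hD0 : ∀ k, ∀ y < 0, 0 ≤ D k y)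
    (hD : ∀ k, ∀ y : ℝ, y < 0 → iteratedDeriv k F y = D k y) :
    ∃ μ : Measure ℝ, μ (Iio 0) = 0 ∧ ∀ w : ℂ, w.re < 0 →
      Integrable (fun s : ℝ => Complex.exp (w * s)) μ ∧
        F w = ∫ s, Complex.exp (w * s) ∂μ := by
  have hopen : IsOpen {w : ℂ | w.re < 0} := isOpen_lt Complex.continuous_re continuous_const
  have hFre : ∀ y : ℝ, y < 0 → F y = ((F y).re : ℂ) := by
    intro y hy
    have := hD 0 y hy
    simp only [iteratedDeriv_zero] at this
    rw [this]; simp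
  have hFpos : ∀ y : ℝ, y < 0 → 0 ≤ (F y).re := by
    intro y hy
    have := hD 0 y hy
    simp only [iteratedDeriv_zero] at this
    rw [this]; simpa using hD0 0 y hy
  let c : ℕ → ℕ → ℝ := fun n k => ((k.factorial : ℝ))⁻¹ * ((n+1 : ℝ))^k * D k (-(n+1 : ℝ))
  have hc0 : ∀ n k, 0 ≤ c n k := by
    intro n k
    have := hD0 k (-(n+1 : ℝ)) (by have : (0:ℝ) ≤ n := by positivity
                                   linarith)
    positivity
  let p : ℕ → ℝ → ℝ := fun n y => (n+1 : ℝ) * (Real.exp (y / (n+1 : ℝ)) - 1)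
  have hp : ∀ n, ∀ y < 0, p n y < 0 := by
    intro n y hy
    have h1 : Real.exp (y / (n+1 : ℝ)) < 1 := by
      rw [← Real.exp_zero]
      exact Real.exp_lt_exp.2 (div_neg_of_neg_of_pos hy (by positivity))
    exact mul_neg_of_pos_of_neg (by positivity) (by linarith)
  have hsum : ∀ n, ∀ y < 0, HasSum (fun k : ℕ => c n k * Real.exp (y * (k / (n+1 : ℝ))))
      (F (p n y : ℝ)).re := by
    intro n y hy
    have hn : (0:ℝ) < n + 1 := by positivity
    have hball : DifferentiableOn ℂ F (Metric.ball (((-(n+1 : ℝ) : ℝ)) : ℂ) (n+1 : ℝ)) := by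
      apply hF.mono
      intro w hw
      have h1 : ‖w - ((-(n+1 : ℝ) : ℝ) : ℂ)‖ < n + 1 := by simpa only [Metric.mem_ball, dist_eq_norm] using hw
      have h2 := (le_abs_self _).trans ((Complex.abs_re_le_norm _).trans h1.le)
      have h3 := (le_abs_self _).trans_lt ((Complex.abs_re_le_norm _).trans_lt h1)
      simp only [Complex.sub_re, Complex.ofReal_re] at h3
      show w.re < 0
      linarith
    have hmem : ((p n y : ℝ) : ℂ) ∈ Metric.ball (((-(n+1 : ℝ) : ℝ)) : ℂ) (n+1 : ℝ) := by
      rw [Metric.mem_ball, dist_eq_norm, ← Complex.ofReal_sub, Complex.norm_real, Real.norm_eq_abs,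
        abs_lt]
      have h1 := hp n y hy
      have h2 : 0 < Real.exp (y / (n+1 : ℝ)) := Real.exp_pos _
      have h3 : p n y = (n+1 : ℝ) * Real.exp (y / (n+1 : ℝ)) - (n+1) := by simp only [p]; ring
      have h4 : 0 < (n+1 : ℝ) * Real.exp (y / (n+1 : ℝ)) := by positivity
      constructor <;> linarith
    have hs := Complex.hasSum_taylorSeries_on_ball hball hmem
    have hs2 := Complex.hasSum_re hs
    convert hs2 using 1
    ext k
    rw [hD k _ (by linarith), ← Complex.ofReal_sub]
    have h3 : p n y - -(n+1 : ℝ) = (n+1 : ℝ) * Real.exp (y / (n+1 : ℝ)) := by simp only [p]; ring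
    rw [h3]
    simp only [smul_eq_mul]
    rw [← Complex.ofReal_natCast, ← Complex.ofReal_inv, ← Complex.ofReal_pow, ← Complex.ofReal_mul,
      ← Complex.ofReal_mul, Complex.ofReal_re, mul_pow, ← Real.exp_nat_mul]
    simp only [c]
    rw [show y * (k / (n+1 : ℝ)) = k * (y / (n+1 : ℝ)) by ring]
    ring
  let ν : ℕ → Measure ℝ := fun n => Measure.sum fun k : ℕ =>
    ENNReal.ofReal (c n k * Real.exp (-(k / (n+1 : ℝ)))) • Measure.dirac ((k : ℝ) / (n+1 : ℝ))
  have hν0 : ∀ n, ν n (Iio 0) = 0 := by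
    intro n
    rw [Measure.sum_apply _ measurableSet_Iio, ENNReal.tsum_eq_zero]
    intro k
    rw [Measure.smul_apply, Measure.dirac_apply' _ measurableSet_Iio, indicator_of_notMem]
    · simp
    · simp only [mem_Iio, not_lt]; positivity
  have hplim : ∀ y < 0, Tendsto (fun n => p n y) atTop (𝓝 y) := by
    intro y hy
    have h1 : HasDerivAt (fun x : ℝ => Real.exp (y * x)) y 0 := by
      have h2 : HasDerivAt (fun x : ℝ => y * x) y 0 := by
        simpa using (hasDerivAt_id (0:ℝ)).const_mul y
      simpa using h2.exp
    have h3 := h1.tendsto_slope_zero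
    have h4 : Tendsto (fun n : ℕ => 1 / ((n:ℝ) + 1)) atTop (𝓝[≠] 0) := by
      rw [tendsto_nhdsWithin_iff]
      refine ⟨tendsto_one_div_add_atTop_nhds_zero_nat, Eventually.of_forall fun n => ?_⟩
      have : (0:ℝ) < 1 / ((n:ℝ) + 1) := by positivity
      exact this.ne'
    refine (h3.comp h4).congr fun n => ?_
    simp [p, div_eq_mul_inv]
  obtain ⟨μ, hμf, hμ0, hμint, hμeq⟩ := aux_measure_limit ν hν0
    (fun n b => (F (p n (b - 1) : ℝ)).re) (fun b => (F ((b - 1 : ℝ) : ℂ)).re)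
    (by
      intro n b hb
      have h1 := hsum n (b - 1) (by linarith)
      simp only [ν]
      rw [lintegral_sum_measure]
      simp only [lintegral_smul_measure]
      rw [← h1.tsum_eq, ENNReal.ofReal_tsum_of_nonneg _ h1.summable]
      · congr 1
        ext k
        rw [lintegral_dirac' _ (by fun_prop), smul_eq_mul, ← ENNReal.ofReal_mul (by have := hc0 n k; positivity),
          mul_assoc, ← Real.exp_add]
        congr 3
        ring_nf
      · intro k
        have := hc0 n k
        positivity)
    (by
      intro b hb
      have h1 : ContinuousAt F ((b - 1 : ℝ) : ℂ) :=
        (hF.differentiableAt (hopen.mem_nhds (by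
          show ((b - 1 : ℝ) : ℂ).re < 0
          rw [Complex.ofReal_re]; linarith))).continuousAt
      have h2 : Tendsto (fun n => ((p n (b - 1) : ℝ) : ℂ)) atTop (𝓝 ((b - 1 : ℝ) : ℂ)) :=
        (Complex.continuous_ofReal.tendsto _).comp (hplim (b - 1) (by linarith))
      exact (Complex.continuous_re.tendsto _).comp (h1.tendsto.comp h2))
  have hset : Iio (1:ℝ) ⊆ ProbabilityTheory.integrableExpSet id μ := fun b hb => hμint b hb
  have hset' : Iio (1:ℝ) ⊆ interior (ProbabilityTheory.integrableExpSet id μ) :=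
    interior_maximal hset isOpen_Iio
  have hHan : AnalyticOnNhd ℂ (fun w => ProbabilityTheory.complexMGF id μ (w + 1)) {w | w.re < 0} := by
    intro w hw
    have hw : w.re < 0 := hw
    have h1 : AnalyticAt ℂ (ProbabilityTheory.complexMGF id μ) (w + 1) :=
      ProbabilityTheory.analyticAt_complexMGF (hset' (by simp; linarith))
    exact h1.fun_comp (f := fun w : ℂ => w + 1) (by fun_prop)
  have hEq : EqOn F (fun w => ProbabilityTheory.complexMGF id μ (w + 1)) {w | w.re < 0} := by
    refine (hF.analyticOnNhd hopen).eqOn_of_preconnected_of_frequently_eq hHan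
      (convex_halfSpace_re_lt 0).isPreconnected (z₀ := ((-2 : ℝ) : ℂ)) (by simp) ?_
    have h1 : Tendsto (fun x : ℝ => (x : ℂ)) (𝓝[≠] (-2 : ℝ)) (𝓝[≠] ((-2 : ℝ) : ℂ)) := by
      refine tendsto_nhdsWithin_of_tendsto_nhds_of_eventually_within _
        ((Complex.continuous_ofReal.tendsto _).mono_left nhdsWithin_le_nhds) ?_
      filter_upwards [self_mem_nhdsWithin] with x hx
      exact fun h => hx (Complex.ofReal_injective h)
    refine h1.frequently (Eventually.frequently ?_)
    filter_upwards [nhdsWithin_le_nhds (Iio_mem_nhds (show (-2:ℝ) < -1 by norm_num))] with y hy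
    have hy : y < -1 := hy
    have h2 : ((y : ℂ) + 1) = ((y + 1 : ℝ) : ℂ) := by push_cast; rfl
    show F y = ProbabilityTheory.complexMGF id μ (y + 1)
    rw [h2, ProbabilityTheory.complexMGF_ofReal, hFre y (by linarith)]
    congr 1
    have h3 := hμeq (y + 1) (by linarith)
    simp only [ProbabilityTheory.mgf, id]
    rw [integral_eq_lintegral_of_nonneg_ae (Eventually.of_forall fun s => Real.exp_nonneg _)
      (by fun_prop), h3, add_sub_cancel_right, ENNReal.toReal_ofReal (hFpos y (by linarith))]
  have hem : Measurable (fun s : ℝ => (Real.exp s).toNNReal) := by fun_prop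
  have hsm : ∀ (w : ℂ) (s : ℝ), (Real.exp s).toNNReal • Complex.exp (w * s) = Complex.exp ((w + 1) * s) := by
    intro w s
    rw [NNReal.smul_def, Real.coe_toNNReal _ (Real.exp_nonneg _), Complex.real_smul, Complex.ofReal_exp,
      ← Complex.exp_add]
    congr 1
    ring
  refine ⟨μ.withDensity (fun s => ((Real.exp s).toNNReal : ℝ≥0∞)),
    withDensity_absolutelyContinuous _ _ hμ0, fun w hw => ⟨?_, ?_⟩⟩
  · rw [integrable_withDensity_iff_integrable_smul hem]
    simp only [hsm]
    have h1 := hμint (w.re + 1) (by linarith)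
    refine h1.mono' (by fun_prop) (Eventually.of_forall fun s => ?_)
    rw [Complex.norm_exp]
    simp
  · rw [integral_withDensity_eq_integral_smul hem]
    simp only [hsm]
    exact hEq hw

theorem stmt_15 (f : ℝ → ℂ) (hc : Continuous f) (hb : ∃ M : ℝ, ∀ x : ℝ, ‖f x‖ ≤ M)
    (hint : Integrable (fun t : ℝ => ‖f t‖ / (1 + |t|)))
    (hre : ∀ y ∈ Iio (0 : ℝ), (-(cauchyTransform f (Complex.I * y))).im = 0)
    (ham : AbsolutelyMonotonicOn
      (fun y : ℝ => (-(cauchyTransform f (Complex.I * y))).re) (Iio 0)) :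
    ∃ η : Measure ℝ, η (Ioi 0) = 0 ∧
      ∀ z : ℂ, z.im < 0 →
        Integrable (fun t : ℝ => Complex.exp (Complex.I * z * t)) η ∧
          cauchyTransform f z = -∫ t in Iic (0 : ℝ), Complex.exp (Complex.I * z * t) ∂η := by
  have hF : DifferentiableOn ℂ (fun w => -(cauchyTransform f (Complex.I * w))) {w | w.re < 0} := by
    apply DifferentiableOn.neg
    refine (aux_cauchy_diff f hc hint).comp (by fun_prop) ?_
    intro w hw
    simpa using hw
  obtain ⟨μ, hμ0, hμ⟩ := aux_bernstein _ hF
    (fun k => iteratedDeriv k (fun y : ℝ => (-(cauchyTransform f (Complex.I * y))).re))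
    (fun k y hy => ham.2 k y hy)
    (fun k y hy => aux_deriv _ hF _ (fun x hx => by
      apply Complex.ext
      · simp
      · simpa using hre x hx) k y hy)
  let e : ℝ ≃ᵐ ℝ := MeasurableEquiv.neg ℝ
  have he : ∀ s, e s = -s := fun s => rfl
  have hη0 : (μ.map e) (Ioi 0) = 0 := by
    rw [e.map_apply]
    convert hμ0 using 2
    ext s
    simp [he]
  refine ⟨μ.map e, hη0, fun z hz => ?_⟩
  obtain ⟨h1, h2⟩ := hμ (-(Complex.I * z)) (by simpa using hz)
  have hfun : ∀ s : ℝ, Complex.exp (Complex.I * z * (e s : ℝ)) = Complex.exp (-(Complex.I * z) * s) := by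
    intro s
    rw [he]
    congr 1
    push_cast
    ring
  constructor
  · rw [integrable_map_equiv]
    simpa only [Function.comp_def, hfun] using h1
  · have hr : (μ.map e).restrict (Iic 0) = μ.map e := by
      apply Measure.restrict_eq_self_of_ae_mem
      filter_upwards [measure_eq_zero_iff_ae_notMem.1 hη0] with s hs
      simpa using hs
    rw [hr, integral_map_equiv]
    simp only [hfun]
    rw [← h2]
    simp only [neg_neg]
    congr 1
    rw [mul_neg, ← mul_assoc, Complex.I_mul_I]
    ring
end
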